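/- arXiv:1501.01695 — 2 statements merged into one kernel-verified Lean document; each statement's English description precedes it below -/
import Mathlib

section
/- Let n ∈ ℕ, fix x₀ ∈ ℝ^n with ‖x₀‖ = 1, let c_g be a positive constant with the order-statistics property below, and set ε_g := sup_{x ≥ 2} (c_g² ln(2x) − 1)/(x − 1). Then for every 0 < α < 1 and every ε with 0 < ε < min((1 − √α)/4, ε_g, 4ε_g²), one has ((1 − √α)/32)·ε/ln(1/ε) < β^max_{ε,α} < ((2 + 2ε_g)/(c_g² ε_g))·ε/ln(1/ε). -/
open MeasureTheory ProbabilityTheory Real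

/-- The canonical probability space of `m` i.i.d. standard Gaussian random variables:
the product measure on `Fin m → ℝ` with each factor `N(0,1)`. -/
noncomputable def stdGaussianPi (m : ℕ) : Measure (Fin m → ℝ) :=
  Measure.pi fun _ => gaussianReal 0 1

/-- The law of an `m × n` Gaussian random matrix with i.i.d. `N(0,1)` entries,
viewed as the product measure on `Fin m → Fin n → ℝ`. -/
noncomputable def gaussianMatrix (m n : ℕ) : Measure (Fin m → Fin n → ℝ) :=
  Measure.pi fun _ => Measure.pi fun _ => gaussianReal 0 1

/-- `absOrd y j = |Y_(j+1)|`: the `(j+1)`-st largest among `|y 0|, …, |y (m-1)|`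
(nonincreasing rearrangement in absolute value). -/
noncomputable def absOrd {m : ℕ} (y : Fin m → ℝ) (j : Fin m) : ℝ :=
  |y (Tuple.sort (fun i => -|y i|) j)|

/-- `c` has the order-statistics property: for every `m ∈ ℕ` and every index `j`
(representing the paper's `j+1 ∈ {1,…,⌊m/2⌋}`), `c √(ln(2m/(j+1))) ≤ E|Y_(j+1)|`. -/
def cgProperty (c : ℝ) : Prop :=
  ∀ (m : ℕ) (j : Fin m), 2 * ((j : ℕ) + 1) ≤ m →
    c * Real.sqrt (Real.log (2 * m / ((j : ℕ) + 1))) ≤ ∫ y, absOrd y j ∂(stdGaussianPi m)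

/-- `‖A_T x‖²` : the squared Euclidean norm of the image of `x` under the submatrix of `A`
keeping the rows with indices in `T`. -/
noncomputable def subNormSq {m n : ℕ} (A : Fin m → Fin n → ℝ) (x : Fin n → ℝ)
    (T : Finset (Fin m)) : ℝ :=
  ∑ i ∈ T, (∑ j, A i j * x j) ^ 2

/-- The event `Ω_{ε,β}`: `|(1/|T|)‖A_T x₀‖² − 1| ≤ ε` for all `T ⊆ {1,…,m}` with
`|Tᶜ| ≤ βm`. -/
def omegaEvent (m n : ℕ) (x₀ : Fin n → ℝ) (ε β : ℝ) : Set (Fin m → Fin n → ℝ) :=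
  {A | ∀ T : Finset (Fin m), (Tᶜ.card : ℝ) ≤ β * m →
    |(1 / (T.card : ℝ)) * subNormSq A x₀ T - 1| ≤ ε}

/-- `β^max_{ε,α}`: the supremum of all `β ∈ [0,1)` such that
`P(Ω_{ε,β}) ≥ 1 − 3 e^{−α(ε²/4−ε³/6)m}` for every `m ∈ ℕ` (with `sSup ∅ = 0` in `ℝ`). -/
noncomputable def betaMax (n : ℕ) (x₀ : Fin n → ℝ) (ε α : ℝ) : ℝ :=
  sSup {β : ℝ | 0 ≤ β ∧ β < 1 ∧ ∀ m : ℕ, 0 < m →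
    ENNReal.ofReal (1 - 3 * Real.exp (-α * (ε ^ 2 / 4 - ε ^ 3 / 6) * m)) ≤
      gaussianMatrix m n (omegaEvent m n x₀ ε β)}

/-- The event on the Gaussian vector `y = A x₀` underlying `omegaEvent`. -/
def vectorEvent (m : ℕ) (ε β : ℝ) : Set (Fin m → ℝ) :=
  {y | ∀ T : Finset (Fin m), (Tᶜ.card : ℝ) ≤ β * m →
    |(1 / (T.card : ℝ)) * ∑ i ∈ T, y i ^ 2 - 1| ≤ ε}

instance (m : ℕ) : IsProbabilityMeasure (stdGaussianPi m) := by
  unfold stdGaussianPi; infer_instance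

lemma measurableSet_vectorEvent (m : ℕ) (ε β : ℝ) : MeasurableSet (vectorEvent m ε β) := by
  simp only [vectorEvent, Set.ofPred_forall]
  refine MeasurableSet.iInter fun T => MeasurableSet.iInter fun _ => ?_
  exact measurableSet_le (by fun_prop) (by fun_prop)

lemma map_sum_mul_stdGaussian {n : ℕ} {x : Fin n → ℝ} (hx : ∑ j, x j ^ 2 = 1) :
    (Measure.pi fun _ : Fin n => gaussianReal 0 1).map (fun a => ∑ j, a j * x j) =
      gaussianReal 0 1 := by
  have hmap : (Measure.pi fun _ : Fin n => gaussianReal 0 1).map (fun a j => a j * x j) =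
      Measure.pi fun j => (gaussianReal 0 1).map (· * x j) := by
    have (j : Fin n) : SigmaFinite ((gaussianReal 0 1).map (· * x j)) := by
      rw [gaussianReal_map_mul_const]; infer_instance
    exact Measure.pi_map_pi (f := fun j (a : ℝ) => a * x j) fun j => by fun_prop
  have hcomp : (Measure.pi fun _ : Fin n => gaussianReal 0 1).map (fun a => ∑ j, a j * x j) =
      (Measure.pi fun j => (gaussianReal 0 1).map (· * x j)).map (fun p => ∑ j, p j) := by
    rw [← hmap, Measure.map_map (by fun_prop) (by fun_prop)]
    rfl
  have (j : Fin n) : IsProbabilityMeasure ((gaussianReal 0 1).map (· * x j)) := by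
    rw [gaussianReal_map_mul_const]; infer_instance
  rw [hcomp]
  refine Measure.ext_of_charFun ?_
  rw [charFun_map_sum_pi_eq_prod]
  ext t
  simp only [Finset.prod_apply, gaussianReal_map_mul_const, charFun_gaussianReal]
  rw [← Complex.exp_sum]
  congr 1
  have hx' : ∑ j, (x j : ℂ) ^ 2 = 1 := by exact_mod_cast hx
  simp only [mul_zero, mul_one, Complex.ofReal_zero, zero_mul, zero_sub, NNReal.coe_mk,
    Finset.sum_neg_distrib, Complex.ofReal_pow, NNReal.coe_one, Complex.ofReal_one]
  rw [← Finset.sum_div, ← Finset.sum_mul, hx']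

lemma gaussianMatrix_omegaEvent {m n : ℕ} {x : Fin n → ℝ} (hx : ∑ j, x j ^ 2 = 1) (ε β : ℝ) :
    gaussianMatrix m n (omegaEvent m n x ε β) = stdGaussianPi m (vectorEvent m ε β) := by
  have hmap : (gaussianMatrix m n).map (fun A i => ∑ j, A i j * x j) = stdGaussianPi m := by
    have (i : Fin m) : SigmaFinite
        ((Measure.pi fun _ : Fin n => gaussianReal 0 1).map fun a => ∑ j, a j * x j) := by
      rw [map_sum_mul_stdGaussian hx]; infer_instance
    unfold gaussianMatrix stdGaussianPi
    rw [Measure.pi_map_pi (f := fun _ (a : Fin n → ℝ) => ∑ j, a j * x j) fun i =>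
      Measurable.aemeasurable (by fun_prop)]
    simp only [map_sum_mul_stdGaussian hx]
  rw [← hmap, Measure.map_apply (by fun_prop) (measurableSet_vectorEvent m ε β)]
  rfl

/-- Chernoff's bound for a sum of functions of i.i.d. standard Gaussian variables. -/
lemma stdGaussianPi_real_sum_ge_le {m : ℕ} {f : ℝ → ℝ}
    (hf : Integrable (fun y => exp (f y)) (gaussianReal 0 1)) {K c : ℝ}
    (hK : ∫ y, exp (f y) ∂gaussianReal 0 1 ≤ exp K) :
    (stdGaussianPi m).real {y | c * m ≤ ∑ i, f (y i)} ≤ exp ((K - c) * m) := by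
  have hprod : (fun y : Fin m → ℝ => exp (1 * ∑ i, f (y i))) =
      fun y => ∏ i, exp (f (y i)) := by
    ext y; rw [one_mul, exp_sum]
  have hmgf : mgf (fun y : Fin m → ℝ => ∑ i, f (y i)) (stdGaussianPi m) 1 =
      (∫ y, exp (f y) ∂gaussianReal 0 1) ^ m := by
    rw [mgf, hprod, stdGaussianPi, integral_fintype_prod_eq_pow (fun y => exp (f y)),
      Fintype.card_fin]
  have h := measure_ge_le_exp_mul_mgf (μ := stdGaussianPi m)
    (X := fun y : Fin m → ℝ => ∑ i, f (y i)) (c * m) zero_le_one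
    (by rw [hprod]; exact Integrable.fintype_prod (f := fun _ y => exp (f y)) fun _ => hf)
  rw [hmgf] at h
  refine h.trans ?_
  calc exp (-1 * (c * m)) * (∫ y, exp (f y) ∂gaussianReal 0 1) ^ m
      ≤ exp (-1 * (c * m)) * exp K ^ m := by
        gcongr
    _ = exp ((K - c) * m) := by
        rw [← exp_nat_mul, ← exp_add]; congr 1; ring

lemma integrable_exp_mul_sq_gaussianReal {l : ℝ} (hl : l < 1 / 2) :
    Integrable (fun y => exp (l * y ^ 2)) (gaussianReal 0 1) := by
  rw [gaussianReal_of_var_ne_zero 0 one_ne_zero,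
    integrable_withDensity_iff_integrable_smul' (measurable_gaussianPDF 0 1)
      (ae_of_all _ fun _ => gaussianPDF_lt_top)]
  have h := (integrable_exp_neg_mul_sq (b := 1 / 2 - l) (by linarith)).const_mul
    (√(2 * π * (1 : NNReal)))⁻¹
  refine h.congr (ae_of_all _ fun y => ?_)
  simp only [toReal_gaussianPDF, gaussianPDFReal, smul_eq_mul, mul_assoc, ← exp_add]
  congr 2
  simp only [NNReal.coe_one]
  ring

lemma integral_exp_mul_sq_gaussianReal {l : ℝ} (hl : l < 1 / 2) :
    ∫ y, exp (l * y ^ 2) ∂gaussianReal 0 1 = exp (-log (1 - 2 * l) / 2) := by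
  rw [integral_gaussianReal_eq_integral_smul one_ne_zero]
  have (y : ℝ) : gaussianPDFReal 0 1 y • exp (l * y ^ 2) =
      (√(2 * π))⁻¹ * exp (-(1 / 2 - l) * y ^ 2) := by
    simp only [gaussianPDFReal, smul_eq_mul, mul_assoc, ← exp_add, NNReal.coe_one, mul_one]
    congr 2
    ring
  simp only [this]
  have hpos : 0 < 1 - 2 * l := by linarith
  rw [integral_const_mul, integral_gaussian, ← sqrt_inv, ← sqrt_mul (by positivity),
    neg_div, exp_neg, ← log_sqrt hpos.le, exp_log (sqrt_pos.2 hpos), ← sqrt_inv]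
  congr 1
  have : (1 / 2 - l) ≠ 0 := by linarith
  field_simp

lemma log_one_add_le_cubic {x : ℝ} (hx : 0 ≤ x) :
    log (1 + x) ≤ x - x ^ 2 / 2 + x ^ 3 / 3 := by
  have hd (t : ℝ) (ht : 0 ≤ t) :
      HasDerivAt (fun t : ℝ => t - t ^ 2 / 2 + t ^ 3 / 3 - log (1 + t)) (t ^ 3 / (1 + t)) t := by
    have ht' : 1 + t ≠ 0 := by positivity
    have h := ((((hasDerivAt_id t).sub (((hasDerivAt_id t).pow 2).div_const 2)).add
      (((hasDerivAt_id t).pow 3).div_const 3)).sub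
      (((hasDerivAt_id t).const_add 1).log ht'))
    refine h.congr_deriv ?_
    simp only [id]
    field_simp
    push_cast
    ring
  have hmono : MonotoneOn (fun t : ℝ => t - t ^ 2 / 2 + t ^ 3 / 3 - log (1 + t)) (Set.Ici 0) := by
    refine monotoneOn_of_deriv_nonneg (convex_Ici 0)
      (fun t ht => (hd t ht).continuousAt.continuousWithinAt)
      (fun t ht => (hd t (interior_subset ht)).differentiableAt.differentiableWithinAt)
      fun t ht => ?_
    have ht' : 0 ≤ t := interior_subset ht
    rw [(hd t ht').deriv]
    positivity
  have := hmono Set.self_mem_Ici hx hx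
  simp only [add_zero, log_one] at this
  linarith

lemma sub_half_sq_le_log_one_add {x : ℝ} (hx : 0 ≤ x) : x - x ^ 2 / 2 ≤ log (1 + x) := by
  refine le_trans ?_ (le_log_one_add_of_nonneg hx)
  rw [le_div_iff₀ (by positivity)]
  nlinarith [pow_nonneg hx 3]

lemma stdGaussianPi_real_sum_sq_upper_tail {m : ℕ} {δ : ℝ} (hδ : 0 ≤ δ) :
    (stdGaussianPi m).real {y | (1 + δ) * m ≤ ∑ i, y i ^ 2} ≤
      exp (-(δ ^ 2 / 4 - δ ^ 3 / 6) * m) := by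
  have hpos : 0 < 1 + δ := by positivity
  set l := δ / (1 + δ) / 2 with hl
  have hl0 : 0 ≤ l := by positivity
  have hlog : 1 - 2 * l = (1 + δ)⁻¹ := by rw [hl]; field_simp; ring
  have hl1 : l < 1 / 2 := by nlinarith [inv_pos.2 hpos]
  have h := stdGaussianPi_real_sum_ge_le (m := m) (c := l * (1 + δ))
    (integrable_exp_mul_sq_gaussianReal hl1) (integral_exp_mul_sq_gaussianReal hl1).le
  refine (measureReal_mono fun y hy => ?_).trans (h.trans (exp_le_exp.2 ?_))
  · simp only [Set.mem_ofPred_eq] at hy ⊢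
    rw [← Finset.mul_sum, mul_assoc]
    gcongr
  · gcongr
    rw [hlog, log_inv, hl]
    have := log_one_add_le_cubic hδ
    field_simp
    linarith

lemma stdGaussianPi_real_sum_sq_lower_tail {m : ℕ} {δ : ℝ} (hδ : 0 ≤ δ) :
    (stdGaussianPi m).real {y | ∑ i, y i ^ 2 ≤ (1 - δ) * m} ≤ exp (-(δ ^ 2 / 4) * m) := by
  have hl : -(δ / 2) < 1 / 2 := by linarith
  have h := stdGaussianPi_real_sum_ge_le (m := m) (c := -(δ / 2) * (1 - δ))
    (integrable_exp_mul_sq_gaussianReal hl) (integral_exp_mul_sq_gaussianReal hl).le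
  refine (measureReal_mono fun y hy => ?_).trans (h.trans (exp_le_exp.2 ?_))
  · simp only [Set.mem_ofPred_eq] at hy ⊢
    rw [← Finset.mul_sum, mul_assoc]
    exact mul_le_mul_of_nonpos_left hy (by linarith)
  · gcongr
    have := sub_half_sq_le_log_one_add hδ
    rw [show 1 - 2 * -(δ / 2) = 1 + δ by ring]
    linarith

lemma stdGaussianPi_real_sum_truncated_tail {m : ℕ} {β : ℝ} (hβ : 0 < β) (c : ℝ) :
    (stdGaussianPi m).real {y | 4 * c * m ≤ ∑ i, max (y i ^ 2 - 4 * log (1 / β)) 0} ≤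
      exp ((√2 * β - c) * m) := by
  set f : ℝ → ℝ := fun y => max (y ^ 2 - 4 * log (1 / β)) 0 / 4 with hf
  have hquarter : (1 / 4 : ℝ) < 1 / 2 := by norm_num
  have hbound (y : ℝ) : exp (f y) ≤ 1 + β * exp (1 / 4 * y ^ 2) := by
    rcases le_total (y ^ 2 - 4 * log (1 / β)) 0 with h | h
    · simp only [hf, max_eq_right h, zero_div, exp_zero]
      have := exp_pos (1 / 4 * y ^ 2)
      nlinarith
    · simp only [hf, max_eq_left h]
      have : exp ((y ^ 2 - 4 * log (1 / β)) / 4) = β * exp (1 / 4 * y ^ 2) := by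
        nth_rewrite 2 [← exp_log hβ]
        rw [← exp_add, one_div, log_inv]
        congr 1
        ring
      linarith
  have hint : Integrable (fun y => 1 + β * exp (1 / 4 * y ^ 2)) (gaussianReal 0 1) :=
    (integrable_const 1).add ((integrable_exp_mul_sq_gaussianReal hquarter).const_mul β)
  have hintf : Integrable (fun y => exp (f y)) (gaussianReal 0 1) := by
    refine hint.mono' (by fun_prop) (ae_of_all _ fun y => ?_)
    rw [norm_of_nonneg (exp_pos _).le]
    exact hbound y
  have hK : ∫ y, exp (f y) ∂gaussianReal 0 1 ≤ exp (√2 * β) := by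
    calc ∫ y, exp (f y) ∂gaussianReal 0 1
        ≤ ∫ y, (1 + β * exp (1 / 4 * y ^ 2)) ∂gaussianReal 0 1 := integral_mono hintf hint hbound
      _ = √2 * β + 1 := by
        rw [integral_add (integrable_const 1)
          ((integrable_exp_mul_sq_gaussianReal hquarter).const_mul β), integral_const_mul,
          integral_exp_mul_sq_gaussianReal hquarter]
        have : -log (1 - 2 * (1 / 4)) / 2 = log √2 := by
          rw [log_sqrt zero_le_two, show (1 - 2 * (1 / 4) : ℝ) = 2⁻¹ by norm_num, log_inv, neg_neg]
        rw [this, exp_log (by positivity)]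
        simp
        ring
      _ ≤ exp (√2 * β) := add_one_le_exp _
  refine (measureReal_mono fun y hy => ?_).trans (stdGaussianPi_real_sum_ge_le (c := c) hintf hK)
  simp only [Set.mem_ofPred_eq, hf, ← Finset.sum_div] at hy ⊢
  linarith

/-- Outside the three bad events, removing a small fraction of the coordinates of `y` barely
changes the average of the squares. -/
lemma mem_vectorEvent_of_sum_bounds {m : ℕ} (hm : 0 < m) {ε β s t : ℝ}
    (hβ1 : β < 1) (hε0 : 0 ≤ ε) (hε1 : ε ≤ 1) (ht : 0 ≤ t) (hs : 1 + s ≤ (1 + ε) * (1 - β))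
    {y : Fin m → ℝ} (hupper : ∑ i, y i ^ 2 ≤ (1 + s) * m) (hlower : (1 - s) * m ≤ ∑ i, y i ^ 2)
    (htrunc : ∑ i, max (y i ^ 2 - t) 0 ≤ (ε - s - t * β) * m) :
    y ∈ vectorEvent m ε β := by
  intro T hT
  have hm' : (0 : ℝ) < m := by exact_mod_cast hm
  have hcard : (T.card : ℝ) + (Tᶜ).card = m := by
    exact_mod_cast T.card_add_card_compl.trans (Fintype.card_fin m)
  have hTle : (1 - β) * m ≤ T.card := by linarith
  have hT0 : (0 : ℝ) < T.card := lt_of_lt_of_le (mul_pos (by linarith) hm') hTle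
  have hsplit : ∑ i ∈ T, y i ^ 2 + ∑ i ∈ Tᶜ, y i ^ 2 = ∑ i, y i ^ 2 :=
    Finset.sum_add_sum_compl T _
  have hc0 : 0 ≤ ∑ i ∈ Tᶜ, y i ^ 2 := Finset.sum_nonneg fun i _ => sq_nonneg _
  have hc1 : ∑ i ∈ Tᶜ, y i ^ 2 ≤ t * (β * m) + ∑ i, max (y i ^ 2 - t) 0 :=
    calc ∑ i ∈ Tᶜ, y i ^ 2 ≤ ∑ i ∈ Tᶜ, (t + max (y i ^ 2 - t) 0) :=
          Finset.sum_le_sum fun i _ => by linarith [le_max_left (y i ^ 2 - t) 0]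
      _ = t * (Tᶜ).card + ∑ i ∈ Tᶜ, max (y i ^ 2 - t) 0 := by
          rw [Finset.sum_add_distrib, Finset.sum_const, nsmul_eq_mul, mul_comm]
      _ ≤ t * (β * m) + ∑ i, max (y i ^ 2 - t) 0 := by
          gcongr
          exact Finset.subset_univ _
  have hup : ∑ i ∈ T, y i ^ 2 ≤ (1 + ε) * T.card := by nlinarith
  have hlow : (1 - ε) * T.card ≤ ∑ i ∈ T, y i ^ 2 := by
    have : (1 - ε) * T.card ≤ (1 - ε) * m := by
      have : (0 : ℝ) ≤ (Tᶜ).card := Nat.cast_nonneg _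
      nlinarith
    linarith
  rw [abs_le, one_div, ← div_eq_inv_mul]
  constructor
  · have := (le_div_iff₀ hT0).2 hlow
    linarith
  · have := (div_le_iff₀ hT0).2 hup
    linarith

lemma one_sub_le_stdGaussianPi_real_vectorEvent {m : ℕ} (hm : 0 < m) {ε β s r : ℝ} (hβ0 : 0 < β)
    (hβ1 : β < 1) (hε0 : 0 ≤ ε) (hε1 : ε ≤ 1) (hs0 : 0 ≤ s) (hs : 1 + s ≤ (1 + ε) * (1 - β))
    (hr : r ≤ s ^ 2 / 4 - s ^ 3 / 6)
    (hr' : r ≤ (ε - s) / 4 - β * (√2 + log (1 / β))) :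
    1 - 3 * exp (-r * m) ≤ (stdGaussianPi m).real (vectorEvent m ε β) := by
  set t := 4 * log (1 / β) with ht
  have ht0 : 0 ≤ t := by
    have : 0 ≤ log (1 / β) := log_nonneg (by rw [le_div_iff₀ hβ0]; linarith)
    positivity
  set U := {y : Fin m → ℝ | (1 + s) * m ≤ ∑ i, y i ^ 2} with hU
  set V := {y : Fin m → ℝ | ∑ i, y i ^ 2 ≤ (1 - s) * m} with hV
  set c := (ε - s - t * β) / 4 with hc
  set W := {y : Fin m → ℝ | 4 * c * m ≤ ∑ i, max (y i ^ 2 - t) 0} with hW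
  have hcover : Set.univ ⊆ vectorEvent m ε β ∪ (U ∪ V ∪ W) := by
    intro y _
    by_cases hy : y ∈ U ∪ V ∪ W
    · exact Or.inr hy
    · left
      simp only [Set.mem_union, not_or, hU, hV, hW, hc, Set.mem_ofPred_eq, not_le] at hy
      exact mem_vectorEvent_of_sum_bounds hm hβ1 hε0 hε1 ht0 hs hy.1.1.le hy.1.2.le
        (by linarith [hy.2])
  have hUb : (stdGaussianPi m).real U ≤ exp (-r * m) :=
    (stdGaussianPi_real_sum_sq_upper_tail hs0).trans (by gcongr)
  have hVb : (stdGaussianPi m).real V ≤ exp (-r * m) :=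
    (stdGaussianPi_real_sum_sq_lower_tail hs0).trans (by gcongr; linarith [pow_nonneg hs0 3])
  have hWb : (stdGaussianPi m).real W ≤ exp (-r * m) :=
    (stdGaussianPi_real_sum_truncated_tail hβ0 c).trans (by gcongr; linarith)
  have h1 : 1 ≤ (stdGaussianPi m).real (vectorEvent m ε β ∪ (U ∪ V ∪ W)) := by
    simpa using measureReal_mono (μ := stdGaussianPi m) hcover
  have h2 := measureReal_union_le (μ := stdGaussianPi m) (vectorEvent m ε β) (U ∪ V ∪ W)
  have h3 := measureReal_union_le (μ := stdGaussianPi m) (U ∪ V) W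
  have h4 := measureReal_union_le (μ := stdGaussianPi m) U V
  linarith

lemma log_one_div_gt_of_lt_quarter {ε : ℝ} (hε0 : 0 < ε) (hε : ε < 1 / 4) :
    1.386 < log (1 / ε) := by
  have : log 4 < log (1 / ε) :=
    log_lt_log (by norm_num) (by rw [lt_div_iff₀ hε0]; linarith)
  linarith [log_two_gt_d9, log_four_eq]

lemma mul_sqrt_two_add_log_le {a ε : ℝ} (hε0 : 0 < ε) (hεa : ε < a) (ha : a < 1 / 4) :
    11 / 80 * (a * ε / log (1 / ε)) * (√2 + log (1 / (11 / 80 * (a * ε / log (1 / ε))))) ≤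
      3 / 4 * (a * ε) := by
  have ha0 : 0 < a := hε0.trans hεa
  have hL := log_one_div_gt_of_lt_quarter hε0 (hεa.trans ha)
  set L := log (1 / ε) with hLdef
  have hL0 : 0 < L := by linarith
  have hlog : log (1 / (11 / 80 * (a * ε / L))) ≤ 1 + 3 * L := by
    have heq : log (1 / (11 / 80 * (a * ε / L))) = log (80 / 11) + log (1 / a) + L + log L := by
      rw [hLdef, ← log_mul (by norm_num) (by positivity), ← log_mul (by positivity)
        (by positivity), ← log_mul (by positivity) hL0.ne', ← hLdef]
      congr 1
      field_simp
    have h1 : log (80 / 11) ≤ 2 := by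
      rw [log_le_iff_le_exp (by norm_num), show (2 : ℝ) = 1 + 1 by norm_num, exp_add]
      nlinarith [exp_one_gt_d9]
    have h2 : log (1 / a) ≤ L := log_le_log (by positivity) (one_div_le_one_div_of_le hε0 hεa.le)
    have h3 := log_le_sub_one_of_pos hL0
    linarith
  have hsqrt : √2 ≤ 1.415 := sqrt_le_iff.2 (by norm_num)
  calc 11 / 80 * (a * ε / L) * (√2 + log (1 / (11 / 80 * (a * ε / L))))
      ≤ 11 / 80 * (a * ε / L) * (60 / 11 * L) := by
        gcongr
        linarith
    _ = 3 / 4 * (a * ε) := by field_simp; norm_num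

lemma lower_bound_lt_betaMax {n : ℕ} {x : Fin n → ℝ} (hx : ∑ j, x j ^ 2 = 1) {α ε : ℝ}
    (hα0 : 0 < α) (hα1 : α < 1) (hε0 : 0 < ε) (hε : ε < (1 - √α) / 4) :
    ((1 - √α) / 32) * (ε / log (1 / ε)) < betaMax n x ε α := by
  set a := (1 - √α) / 4 with ha
  have hsα : 0 < √α := sqrt_pos.2 hα0
  have hsα1 : √α < 1 := by rw [sqrt_lt' one_pos]; simpa using hα1
  have hsq : √α ^ 2 = α := sq_sqrt hα0.le
  have ha0 : 0 < a := hε0.trans hε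
  have ha1 : a < 1 / 4 := by linarith
  have hL := log_one_div_gt_of_lt_quarter hε0 (hε.trans ha1)
  have hnum := mul_sqrt_two_add_log_le hε0 hε ha1
  set L := log (1 / ε) with hLdef
  have hL0 : 0 < L := by linarith
  set β := 11 / 80 * (a * ε / L) with hβ
  have hβ0 : 0 < β := by positivity
  have hβle : β ≤ a * ε / 8 := by
    have : a * ε / L ≤ a * ε / (11 / 10) := by gcongr; linarith
    rw [hβ]
    linarith
  have hlt : (1 - √α) / 32 * (ε / L) < β := by
    have : (1 - √α) / 32 * (ε / L) = 1 / 8 * (a * ε / L) := by rw [ha]; ring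
    rw [this, hβ]
    have : 0 < a * ε / L := by positivity
    linarith
  have haε : 0 < a * ε := by positivity
  have hβ1 : β < 1 := by nlinarith
  refine hlt.trans_le (le_csSup ⟨1, fun b hb => hb.2.1.le⟩ ⟨hβ0.le, hβ1, fun m hm => ?_⟩)
  rw [gaussianMatrix_omegaEvent hx]
  refine ENNReal.ofReal_le_of_le_toReal ?_
  have hs : √α = 1 - 4 * a := by rw [ha]; ring
  have h := one_sub_le_stdGaussianPi_real_vectorEvent hm (s := √α * ε)
    (r := α * (ε ^ 2 / 4 - ε ^ 3 / 6)) hβ0 hβ1 hε0.le (by linarith) (by positivity)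
    (by rw [hs]; nlinarith) ?_ ?_
  · rwa [← neg_mul] at h
  · have : (√α * ε) ^ 2 / 4 - (√α * ε) ^ 3 / 6 - α * (ε ^ 2 / 4 - ε ^ 3 / 6) =
        α * (1 - √α) * ε ^ 3 / 6 := by
      rw [mul_pow, mul_pow, pow_succ (√α) 2, hsq]; ring
    have : 0 ≤ α * (1 - √α) * ε ^ 3 / 6 := by
      have : 0 ≤ 1 - √α := by linarith
      positivity
    linarith
  · have h1 : (ε - √α * ε) / 4 = a * ε := by rw [ha]; ring
    have h2 : α * (ε ^ 2 / 4 - ε ^ 3 / 6) ≤ a * ε / 4 := by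
      have : 0 ≤ ε ^ 2 / 4 - ε ^ 3 / 6 := by nlinarith [sq_nonneg ε]
      nlinarith [pow_pos hε0 3]
    linarith

lemma exists_finset_card_mul_absOrd_sq_le {m : ℕ} (y : Fin m → ℝ) (j : Fin m) :
    ∃ T : Finset (Fin m), Tᶜ.card = (j : ℕ) + 1 ∧
      ((j : ℝ) + 1) * absOrd y j ^ 2 ≤ ∑ i ∈ Tᶜ, y i ^ 2 := by
  set σ := Tuple.sort (fun i => -|y i|) with hσ
  refine ⟨((Finset.Iic j).map σ.toEmbedding)ᶜ, ?_, ?_⟩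
  · simp
  · rw [compl_compl, Finset.sum_map]
    have hmono : Monotone ((fun i => -|y i|) ∘ σ) := Tuple.monotone_sort _
    have : ∑ _i ∈ Finset.Iic j, absOrd y j ^ 2 ≤
        ∑ i ∈ Finset.Iic j, y (σ.toEmbedding i) ^ 2 := by
      refine Finset.sum_le_sum fun i hi => ?_
      have h : -|y (σ i)| ≤ -|y (σ j)| := hmono (Finset.mem_Iic.1 hi)
      refine sq_le_sq.2 ?_
      rw [absOrd, abs_abs]
      exact neg_le_neg_iff.1 h
    simpa using this

lemma mul_absOrd_sq_le_of_mem_vectorEvent {m : ℕ} {ε β : ℝ} {y : Fin m → ℝ}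
    (hy : y ∈ vectorEvent m ε β) {j : Fin m} (hjm : (j : ℕ) + 1 < m)
    (hj : (j : ℝ) + 1 ≤ β * m) :
    ((j : ℝ) + 1) * absOrd y j ^ 2 ≤ ∑ i, y i ^ 2 - (1 - ε) * (m - (j + 1)) := by
  obtain ⟨T, hT, hle⟩ := exists_finset_card_mul_absOrd_sq_le y j
  have hTc : (Tᶜ.card : ℝ) = j + 1 := by exact_mod_cast hT
  have hcard : (T.card : ℝ) + (Tᶜ).card = m := by
    exact_mod_cast T.card_add_card_compl.trans (Fintype.card_fin m)
  have hjm' : (j : ℝ) + 1 < m := by exact_mod_cast hjm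
  have hT0 : (0 : ℝ) < T.card := by linarith
  have h := (abs_le.1 (hy T (by linarith))).1
  rw [one_div, ← div_eq_inv_mul] at h
  have h2 : (1 - ε) * T.card ≤ ∑ i ∈ T, y i ^ 2 := (le_div_iff₀ hT0).1 (by linarith)
  have hsplit : ∑ i ∈ T, y i ^ 2 + ∑ i ∈ Tᶜ, y i ^ 2 = ∑ i, y i ^ 2 :=
    Finset.sum_add_sum_compl T _
  rw [show (m : ℝ) - (j + 1) = T.card by linarith]
  linarith

lemma mul_absOrd_sq_le_sum_sq {m : ℕ} (y : Fin m → ℝ) (j : Fin m) :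
    ((j : ℝ) + 1) * absOrd y j ^ 2 ≤ ∑ i, y i ^ 2 := by
  obtain ⟨T, -, hle⟩ := exists_finset_card_mul_absOrd_sq_le y j
  exact hle.trans (Finset.sum_le_sum_of_subset_of_nonneg (Finset.subset_univ _)
    fun i _ _ => sq_nonneg _)

lemma integral_sq_gaussianReal : ∫ y, y ^ 2 ∂gaussianReal 0 1 = 1 := by
  have h := variance_eq_sub (memLp_id_gaussianReal (μ := 0) (v := 1) 2)
  rw [variance_id_gaussianReal] at h
  simpa using h.symm

lemma integrable_sq_eval_stdGaussianPi {m : ℕ} (i : Fin m) :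
    Integrable (fun y : Fin m → ℝ => y i ^ 2) (stdGaussianPi m) :=
  integrable_comp_eval (X := fun _ => ℝ) (μ := fun _ => gaussianReal 0 1)
    (f := fun y : ℝ => y ^ 2) (memLp_id_gaussianReal 2).integrable_sq

lemma integral_sum_sq_stdGaussianPi (m : ℕ) :
    ∫ y, ∑ i, y i ^ 2 ∂stdGaussianPi m = m := by
  rw [integral_finsetSum _ fun i _ => integrable_sq_eval_stdGaussianPi i]
  have (i : Fin m) : ∫ y, y i ^ 2 ∂stdGaussianPi m = 1 := by
    rw [← integral_sq_gaussianReal]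
    exact integral_comp_eval (X := fun _ => ℝ) (μ := fun _ => gaussianReal 0 1)
      (f := fun y : ℝ => y ^ 2) (Measurable.aestronglyMeasurable (by fun_prop))
  simp [this]

lemma cgProperty.mul_log_le {cg : ℝ} (hcg : 0 < cg) (h : cgProperty cg) {m k : ℕ} (hk : 0 < k)
    (hkm : 2 * k ≤ m) {ε β : ℝ} (hkβ : (k : ℝ) ≤ β * m) :
    k * (cg ^ 2 * log (2 * m / k)) ≤
      m - (1 - ε) * (m - k) * (stdGaussianPi m).real (vectorEvent m ε β) := by
  obtain ⟨j, rfl⟩ : ∃ j, k = j + 1 := ⟨k - 1, by omega⟩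
  push_cast at hkβ ⊢
  set i : Fin m := ⟨j, by omega⟩ with hi
  set a := cg * √(log (2 * m / ((j : ℝ) + 1))) with ha
  have hlog : 0 < log (2 * m / ((j : ℝ) + 1)) := by
    refine log_pos ?_
    rw [lt_div_iff₀ (by positivity)]
    have : 2 * ((j : ℝ) + 1) ≤ m := by exact_mod_cast hkm
    have : (0 : ℝ) ≤ j := Nat.cast_nonneg j
    linarith
  have ha0 : 0 < a := mul_pos hcg (sqrt_pos.2 hlog)
  have hE : a ≤ ∫ y, absOrd y i ∂stdGaussianPi m := h m i hkm
  have hint : Integrable (fun y => absOrd y i) (stdGaussianPi m) :=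
    not_imp_comm.1 integral_undef (ha0.trans_le hE).ne'
  have hind : Integrable ((vectorEvent m ε β).indicator fun _ => (1 : ℝ)) (stdGaussianPi m) :=
    (integrable_const 1).indicator (measurableSet_vectorEvent m ε β)
  have hpoint (y : Fin m → ℝ) : ((j : ℝ) + 1) * (2 * a * absOrd y i - a ^ 2) ≤
      ∑ l, y l ^ 2 -
        (1 - ε) * (m - (j + 1)) * (vectorEvent m ε β).indicator (fun _ => (1 : ℝ)) y := by
    have h1 : ((j : ℝ) + 1) * (2 * a * absOrd y i - a ^ 2) ≤ ((j : ℝ) + 1) * absOrd y i ^ 2 := by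
      gcongr
      nlinarith [sq_nonneg (absOrd y i - a)]
    refine h1.trans ?_
    by_cases hy : y ∈ vectorEvent m ε β
    · rw [Set.indicator_of_mem hy, mul_one]
      exact mul_absOrd_sq_le_of_mem_vectorEvent hy (j := i) (by simp only [hi]; omega) hkβ
    · rw [Set.indicator_of_notMem hy, mul_zero, sub_zero]
      exact mul_absOrd_sq_le_sum_sq y i
  have hmono := integral_mono (μ := stdGaussianPi m)
    (((hint.const_mul (2 * a)).sub (integrable_const (a ^ 2))).const_mul ((j : ℝ) + 1))
    ((integrable_finsetSum Finset.univ fun l _ => integrable_sq_eval_stdGaussianPi l).sub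
      (hind.const_mul ((1 - ε) * (m - (j + 1))))) hpoint
  simp only [Pi.sub_apply] at hmono
  rw [integral_const_mul, integral_sub (hint.const_mul _) (integrable_const _), integral_const_mul,
    integral_sub (integrable_finsetSum _ fun l _ => integrable_sq_eval_stdGaussianPi l)
      (hind.const_mul _), integral_const_mul, integral_sum_sq_stdGaussianPi,
    integral_indicator_const _ (measurableSet_vectorEvent m ε β)] at hmono
  simp only [integral_const, probReal_univ, smul_eq_mul, one_mul, mul_one] at hmono
  refine le_trans ?_ hmono
  have hsq : cg ^ 2 * log (2 * m / ((j : ℝ) + 1)) = a ^ 2 := by rw [ha, mul_pow, sq_sqrt hlog.le]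
  rw [hsq]
  gcongr
  nlinarith

open Filter Topology in
lemma cgProperty.mul_log_le_of_vectorEvent {cg : ℝ} (hcg : 0 < cg) (h : cgProperty cg)
    {ε β r : ℝ} (hε1 : ε ≤ 1) (hr : 0 < r)
    (hβ : ∀ m : ℕ, 0 < m → 1 - 3 * exp (-r * m) ≤ (stdGaussianPi m).real (vectorEvent m ε β))
    {x : ℝ} (hx : 2 ≤ x) (hβx : 1 ≤ β * x) :
    cg ^ 2 * log (2 * x) ≤ 1 + ε * (x - 1) := by
  have hx0 : 0 < x := by linarith
  have hq : Tendsto (fun m : ℕ => (⌊x⁻¹ * (m : ℝ)⌋₊ : ℝ) / m) atTop (𝓝 x⁻¹) :=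
    (tendsto_nat_floor_mul_div_atTop (inv_nonneg.2 hx0.le)).comp tendsto_natCast_atTop_atTop
  have hexp : Tendsto (fun m : ℕ => exp (-r * m)) atTop (𝓝 0) := by
    refine tendsto_exp_atBot.comp ?_
    exact tendsto_natCast_atTop_atTop.const_mul_atTop_of_neg (by linarith)
  have hdiv : Tendsto (fun m : ℕ => 2 / ((⌊x⁻¹ * (m : ℝ)⌋₊ : ℝ) / m)) atTop (𝓝 (2 / x⁻¹)) :=
    tendsto_const_nhds.div hq (inv_ne_zero hx0.ne')
  have hlhs := hq.mul ((hdiv.log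
    (div_ne_zero two_ne_zero (inv_ne_zero hx0.ne'))).const_mul (cg ^ 2))
  have hrhs := (((hq.const_sub 1).const_mul (1 - ε)).mul
    ((hexp.const_mul 3).const_sub 1)).const_sub 1
  have hlim := le_of_tendsto_of_tendsto hlhs hrhs ?_
  · rw [div_inv_eq_mul] at hlim
    have := mul_le_mul_of_nonneg_left hlim hx0.le
    rw [mul_inv_cancel_left₀ hx0.ne'] at this
    refine this.trans_eq ?_
    field_simp
    ring
  · filter_upwards [eventually_ge_atTop ⌈x⌉₊] with m hm
    have hmx : x ≤ m := Nat.ceil_le.1 hm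
    have hm0 : (0 : ℝ) < m := hx0.trans_le hmx
    set k := ⌊x⁻¹ * (m : ℝ)⌋₊ with hk
    have hk0 : 0 < k := Nat.floor_pos.2 (by rw [← div_eq_inv_mul, le_div_iff₀ hx0]; linarith)
    have hkle : (k : ℝ) ≤ x⁻¹ * m := Nat.floor_le (by positivity)
    have hxinv : x⁻¹ ≤ 2⁻¹ := inv_anti₀ two_pos hx
    have hkm : 2 * k ≤ m := by
      have : (2 : ℝ) * k ≤ m := by nlinarith
      exact_mod_cast this
    have hkm' : (k : ℝ) ≤ m := by exact_mod_cast (by omega : k ≤ m)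
    have hkβ : (k : ℝ) ≤ β * m := by
      have : x⁻¹ ≤ β := (inv_le_iff_one_le_mul₀ hx0).2 hβx
      nlinarith
    have hmain := h.mul_log_le hcg hk0 hkm (ε := ε) hkβ
    have hprob := hβ m (by exact_mod_cast hm0)
    have hmain' : k * (cg ^ 2 * log (2 * m / k)) ≤
        m - (1 - ε) * (m - k) * (1 - 3 * exp (-r * m)) := by
      refine hmain.trans ?_
      gcongr
    have hk0' : (0 : ℝ) < k := by exact_mod_cast hk0
    have hdivk : 2 / ((k : ℝ) / m) = 2 * m / k := by field_simp
    rw [hdivk, ← mul_le_mul_iff_of_pos_right hm0]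
    calc (k : ℝ) / m * (cg ^ 2 * log (2 * m / k)) * m = k * (cg ^ 2 * log (2 * m / k)) := by
          field_simp
      _ ≤ _ := hmain'
      _ = _ := by field_simp

/-- If `y ↦ (c log (2 * y) - 1) / (y - 1)` attains its maximum `e` over `[2, ∞)` at `y`, then
`c ≤ e * y`, with equality unless `y = 2`. -/
lemma le_mul_and_eq_of_isMax {c e y : ℝ} (hy : 2 ≤ y)
    (hmax : ∀ x, 2 ≤ x → c * log (2 * x) - 1 ≤ e * (x - 1))
    (heq : c * log (2 * y) - 1 = e * (y - 1)) (hc : 0 < c) (he : 0 < e) :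
    c ≤ e * y ∧ (y = 2 ∨ c = e * y) := by
  have hy0 : 0 < y := by linarith
  have hdiff (x : ℝ) (hx : 2 ≤ x) : c * log (x / y) ≤ e * (x - y) := by
    have hx0 : 0 < x := by linarith
    have h := hmax x hx
    rw [log_mul two_ne_zero hx0.ne'] at h
    rw [log_mul two_ne_zero hy0.ne'] at heq
    rw [log_div hx0.ne' hy0.ne']
    linarith
  have hle : c ≤ e * y := by
    rw [mul_comm, ← div_le_iff₀ he]
    refine le_of_forall_gt_imp_ge_of_dense fun x hx => ?_
    have hx0 : 0 < x := hy0.trans hx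
    have h := hdiff x (hy.trans hx.le)
    have h1 := one_sub_inv_le_log_of_pos (div_pos hx0 hy0)
    have h2 : c * (1 - (x / y)⁻¹) ≤ e * (x - y) := (mul_le_mul_of_nonneg_left h1 hc.le).trans h
    have h3 : c * (1 - (x / y)⁻¹) = c / x * (x - y) := by field_simp
    rw [h3] at h2
    have h4 := le_of_mul_le_mul_right h2 (sub_pos.2 hx)
    rw [div_le_iff₀ hx0] at h4
    rw [div_le_iff₀ he]
    linarith
  refine ⟨hle, ?_⟩
  rcases hy.eq_or_lt with rfl | hy2
  · exact Or.inl rfl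
  · refine Or.inr (le_antisymm hle ?_)
    rw [mul_comm, ← le_div_iff₀ he]
    refine le_of_forall_lt_imp_le_of_dense fun x hx => ?_
    rcases le_or_gt x 2 with hx2 | hx2
    · have h := hdiff 2 le_rfl
      have h1 : log (2 / y) ≤ 2 / y - 1 := log_le_sub_one_of_pos (by positivity)
      have h1' : -log (2 / y) = log (y / 2) := by rw [← log_inv, inv_div]
      have h2 := log_le_sub_one_of_pos (by positivity : (0 : ℝ) < y / 2)
      have h3 : e * (y - 2) ≤ c / 2 * (y - 2) := by
        calc e * (y - 2) ≤ c * log (y / 2) := by rw [← h1']; linarith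
          _ ≤ c * (y / 2 - 1) := by gcongr
          _ = c / 2 * (y - 2) := by ring
      have h4 := le_of_mul_le_mul_right h3 (sub_pos.2 hy2)
      rw [le_div_iff₀ he]
      nlinarith
    · have hx0 : 0 < x := by linarith
      have h := hdiff x hx2.le
      have h1' : -log (x / y) = log (y / x) := by rw [← log_inv, inv_div]
      have h2 := log_le_sub_one_of_pos (div_pos hy0 hx0)
      have h3 : e * (y - x) ≤ c / x * (y - x) := by
        calc e * (y - x) ≤ c * log (y / x) := by rw [← h1']; linarith
          _ ≤ c * (y / x - 1) := by gcongr
          _ = c / x * (y - x) := by field_simp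
      have h4 := le_of_mul_le_mul_right h3 (sub_pos.2 hx)
      rw [le_div_iff₀ hx0] at h4
      rw [le_div_iff₀ he]
      linarith

/-- The comparison at the boundary maximiser `y = 2`. -/
lemma mul_sub_one_lt_of_isMax_two {c e ε : ℝ} (hc : 0 < c) (hce : c ≤ 2 * e)
    (heq : c * log 4 - 1 = e) (hε0 : 0 < ε)
    (hX : 2 ≤ c * e / (2 + 2 * e) * (log (1 / ε) / ε)) :
    ε * (c * e / (2 + 2 * e) * (log (1 / ε) / ε) - 1) <
      c * log (2 * (c * e / (2 + 2 * e) * (log (1 / ε) / ε))) - 1 := by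
  have he : 0 < e := by linarith
  set L := log (1 / ε) with hL
  set X := c * e / (2 + 2 * e) * (L / ε) with hXdef
  have hl2 := log_two_gt_d9
  have hl2' := log_two_lt_d9
  have hX0 : 0 < X := by linarith
  have hl0 : 0 < log 4 := by rw [log_four_eq]; linarith
  have hlogX : log (2 * X) = log 4 + log (X / 2) := by
    rw [← log_mul (by norm_num) (by positivity)]
    congr 1
    ring
  have hceq : c = (1 + e) / log 4 := by
    rw [eq_div_iff hl0.ne']
    linarith
  have hεX : ε * X = e * L / (2 * log 4) := by
    rw [hXdef, hceq]
    field_simp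
  rw [hlogX]
  rcases le_or_gt L (2 * log 4) with hLle | hLgt
  · have h1 : e * L / (2 * log 4) ≤ e := by
      rw [div_le_iff₀ (by positivity)]
      nlinarith
    have h2 : 0 ≤ log (X / 2) := log_nonneg (by linarith)
    have h3 := mul_nonneg hc.le h2
    linarith
  · have he2 : 1 / 2 ≤ e := by
      rw [log_four_eq] at heq
      nlinarith
    have hεX' : e < ε * X := by
      rw [hεX, lt_div_iff₀ (by positivity)]
      nlinarith
    have h1 : 1 / ε / 4 ≤ X / 2 := by
      rw [div_div, div_le_iff₀ (by positivity)]
      nlinarith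
    have h2 : L - log 4 ≤ log (X / 2) := by
      rw [hL, ← log_div (by positivity) (by norm_num)]
      exact log_le_log (by positivity) h1
    have h3 := mul_le_mul_of_nonneg_left h2 hc.le
    have h4 : e * L / (2 * log 4) < e + c * (L - log 4) := by
      rw [hceq, div_lt_iff₀ (by positivity)]
      have : (e + (1 + e) / log 4 * (L - log 4)) * (2 * log 4) =
          2 * (e * log 4 + (1 + e) * (L - log 4)) := by
        field_simp
      rw [this]
      nlinarith
    linarith

/-- The comparison at an interior maximiser `y`, where `c = e * y`. -/
lemma mul_sub_one_lt_of_isMax_interior {c e ε y : ℝ} (he : 0 < e) (hy : 2 ≤ y)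
    (hc : c = e * y) (heq : c * log (2 * y) - 1 = e * (y - 1)) (hε0 : 0 < ε) (hεe : ε < e)
    (hX : y ≤ c * e / (2 + 2 * e) * (log (1 / ε) / ε)) :
    ε * (c * e / (2 + 2 * e) * (log (1 / ε) / ε) - 1) <
      c * log (2 * (c * e / (2 + 2 * e) * (log (1 / ε) / ε))) - 1 := by
  have hy0 : 0 < y := by linarith
  have hc0 : 0 < c := by rw [hc]; positivity
  set L := log (1 / ε) with hL
  set X := c * e / (2 + 2 * e) * (L / ε) with hXdef
  have hX0 : 0 < X := by linarith
  set w := e * L / (2 + 2 * e) with hw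
  set r := ε / e with hr
  have hr0 : 0 < r := by positivity
  have hr1 : r < 1 := by rw [hr, div_lt_one he]; exact hεe
  set z := X / y with hz
  have hz1 : 1 ≤ z := by rw [hz, le_div_iff₀ hy0]; linarith
  have hlogz0 : 0 ≤ log z := log_nonneg hz1
  have hzw : z = w / r := by
    rw [hz, hXdef, hw, hr, hc]
    field_simp
  have hw0 : 0 < w := by
    have : w = z * r := by rw [hzw]; field_simp
    rw [this]
    positivity
  have hkey : 1 / 2 ≤ 1 + log z - w := by
    rcases le_or_gt w (1 / 2) with hwle | hwgt
    · linarith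
    have hl2 := log_two_gt_d9
    have hl2' := log_two_lt_d9
    have hlog2y : log 4 ≤ log (2 * y) := log_le_log (by norm_num) (by linarith)
    have he1 : e ≤ 0.6 := by
      rw [log_four_eq] at hlog2y
      have h1 : e * (y * (log (2 * y) - 1) + 1) = 1 := by rw [hc] at heq; linarith
      have h2 : 2 * 0.386 ≤ y * (log (2 * y) - 1) := by gcongr; linarith
      nlinarith
    have hlogw : -0.6932 ≤ log w := by
      have : log 2⁻¹ ≤ log w := log_le_log (by norm_num) (by linarith)
      rw [log_inv] at this
      linarith
    have hlogz : log z = log w - log r := by rw [hzw, log_div hw0.ne' hr0.ne']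
    have hlogr : log r < 0 := log_neg hr0 hr1
    have hLsum : L = -log e - log r := by
      rw [hL, one_div, log_inv, hr, log_div hε0.ne' he.ne']
      ring
    have heloge : -(e * log e) ≤ 0.37 := by
      have h1 := log_le_sub_one_of_pos (x := 1 / (e * exp 1)) (by positivity)
      rw [one_div, log_inv, log_mul he.ne' (exp_pos 1).ne', log_exp] at h1
      have h2 : -log e ≤ (e * exp 1)⁻¹ := by linarith
      have h3 := mul_le_mul_of_nonneg_left h2 he.le
      have h4 : e * (e * exp 1)⁻¹ = (exp 1)⁻¹ := by field_simp
      have h5 : (exp 1)⁻¹ ≤ 0.37 := by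
        rw [inv_le_comm₀ (exp_pos 1) (by norm_num)]
        norm_num
        linarith [exp_one_gt_d9]
      linarith
    have hwbound : w * (2 + 2 * e) = -(e * log e) + e * -log r := by
      rw [hw, hLsum]
      field_simp
      ring
    have hratio : w ≤ 0.185 + 0.1875 * -log r := by
      have h1 : w * (2 + 2 * e) ≤ (0.185 + 0.1875 * -log r) * (2 + 2 * e) := by
        rw [hwbound]
        nlinarith
      exact le_of_mul_le_mul_right h1 (by positivity)
    linarith
  have hεX : ε * X = c * w := by rw [hXdef, hw]; field_simp
  have hlogX : log (2 * X) = log (2 * y) + log z := by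
    rw [← log_mul (by positivity) (by positivity), hz]
    congr 1
    field_simp
  have hεr : ε = e * r := by rw [hr]; field_simp
  have hlast : e * (1 - r) < c * (1 + log z - w) := by
    have h1 : e ≤ c * (1 / 2) := by rw [hc]; nlinarith
    have h2 : c * (1 / 2) ≤ c * (1 + log z - w) := by gcongr
    nlinarith
  have : ε * X - ε < c * log (2 * y) - 1 + c * log z := by
    rw [hεX, heq]
    have : e * (y - 1) = c - e := by rw [hc]; ring
    linarith
  rw [hlogX]
  linarith

lemma exists_lt_and_mul_sub_one_lt {c e ε : ℝ} (hc : 0 < c)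
    (he : e = sSup {t : ℝ | ∃ x : ℝ, 2 ≤ x ∧ t = (c * log (2 * x) - 1) / (x - 1)})
    (hε0 : 0 < ε) (hεe : ε < e) :
    ∃ x, 2 ≤ x ∧ c * e / (2 + 2 * e) * (log (1 / ε) / ε) < x ∧
      ε * (x - 1) < c * log (2 * x) - 1 := by
  set A := {t : ℝ | ∃ x : ℝ, 2 ≤ x ∧ t = (c * log (2 * x) - 1) / (x - 1)} with hA
  set X := c * e / (2 + 2 * e) * (log (1 / ε) / ε) with hX
  have he0 : 0 < e := hε0.trans hεe
  have hne : A.Nonempty := ⟨_, 2, le_rfl, rfl⟩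
  have hbdd : BddAbove A := by
    by_contra hb
    rw [Real.sSup_of_not_bddAbove hb] at he
    linarith
  by_contra! h
  obtain ⟨_, ⟨x₀, hx₀, rfl⟩, hlt⟩ := exists_lt_of_lt_csSup hne (he ▸ hεe)
  have hx₀X : x₀ ≤ X := by
    by_contra! hlt'
    rw [lt_div_iff₀ (by linarith)] at hlt
    linarith [h x₀ hx₀ hlt']
  have hX2 : 2 ≤ X := hx₀.trans hx₀X
  have hcont : ContinuousOn (fun x : ℝ => (c * log (2 * x) - 1) / (x - 1)) (Set.Icc 2 X) := by
    refine ContinuousOn.div ?_ (by fun_prop) fun x hx => by linarith [hx.1]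
    refine ContinuousOn.sub (continuousOn_const.mul (ContinuousOn.log (by fun_prop) ?_))
      continuousOn_const
    intro x hx
    linarith [hx.1]
  obtain ⟨y, hy, hymax⟩ := isCompact_Icc.exists_isMaxOn ⟨2, le_rfl, hX2⟩ hcont
  have hey : e = (c * log (2 * y) - 1) / (y - 1) := by
    refine le_antisymm (he ▸ csSup_le hne ?_) (he ▸ le_csSup hbdd ⟨y, hy.1, rfl⟩)
    rintro _ ⟨x, hx, rfl⟩
    rcases le_or_gt x X with hxX | hxX
    · exact hymax ⟨hx, hxX⟩
    · refine le_trans ?_ (hlt.le.trans (hymax ⟨hx₀, hx₀X⟩))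
      rw [div_le_iff₀ (by linarith)]
      exact h x hx hxX
  have hmax (x : ℝ) (hx : 2 ≤ x) : c * log (2 * x) - 1 ≤ e * (x - 1) := by
    rw [← div_le_iff₀ (by linarith)]
    exact he ▸ le_csSup hbdd ⟨x, hx, rfl⟩
  have heq : c * log (2 * y) - 1 = e * (y - 1) := by
    rw [eq_div_iff (by linarith [hy.1])] at hey
    exact hey.symm
  have hXle : c * log (2 * X) - 1 ≤ ε * (X - 1) := by
    have hlogc : ContinuousAt (fun x : ℝ => c * log (2 * x) - 1) X :=
      (continuousAt_const.mul (ContinuousAt.log (by fun_prop) (by linarith))).sub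
        continuousAt_const
    have hlin : ContinuousAt (fun x : ℝ => ε * (x - 1)) X := by fun_prop
    refine le_of_tendsto_of_tendsto (b := nhdsWithin X (Set.Ioi X))
      (hlogc.tendsto.mono_left nhdsWithin_le_nhds) (hlin.tendsto.mono_left nhdsWithin_le_nhds) ?_
    filter_upwards [self_mem_nhdsWithin] with x hx
    exact h x (hX2.trans (le_of_lt hx)) hx
  obtain ⟨hcy, hor⟩ := le_mul_and_eq_of_isMax hy.1 hmax heq hc he0
  refine hXle.not_gt ?_
  by_cases hcey : c = e * y
  · exact mul_sub_one_lt_of_isMax_interior he0 hy.1 hcey heq hε0 hεe hy.2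
  · obtain rfl := hor.resolve_right hcey
    refine mul_sub_one_lt_of_isMax_two hc (by linarith) ?_ hε0 hX2
    rw [show (4 : ℝ) = 2 * 2 by norm_num]
    linarith

lemma betaMax_lt_upper_bound {n : ℕ} {x₀ : Fin n → ℝ} (hx₀ : ∑ j, x₀ j ^ 2 = 1) {cg : ℝ}
    (hcg : 0 < cg) (hcgProp : cgProperty cg) {e : ℝ}
    (he : e = sSup {t : ℝ | ∃ x : ℝ, 2 ≤ x ∧ t = (cg ^ 2 * log (2 * x) - 1) / (x - 1)})
    {α ε : ℝ} (hα0 : 0 < α) (hε0 : 0 < ε) (hε1 : ε < 1) (hεe : ε < e) :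
    betaMax n x₀ ε α < ((2 + 2 * e) / (cg ^ 2 * e)) * (ε / log (1 / ε)) := by
  have he0 : 0 < e := hε0.trans hεe
  have hL0 : 0 < log (1 / ε) := log_pos (by rw [lt_div_iff₀ hε0]; linarith)
  obtain ⟨x, hx, hXx, hlt⟩ := exists_lt_and_mul_sub_one_lt (by positivity) he hε0 hεe
  have hx0 : 0 < x := by linarith
  have hr : 0 < α * (ε ^ 2 / 4 - ε ^ 3 / 6) := by
    refine mul_pos hα0 ?_
    nlinarith [pow_pos hε0 2]
  have hle : betaMax n x₀ ε α ≤ x⁻¹ := by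
    refine Real.sSup_le ?_ (inv_nonneg.2 hx0.le)
    rintro β ⟨-, -, hβ⟩
    by_contra! hxβ
    refine absurd hlt (not_lt.2 ?_)
    have hprob (m : ℕ) (hm : 0 < m) : 1 - 3 * exp (-(α * (ε ^ 2 / 4 - ε ^ 3 / 6)) * m) ≤
        (stdGaussianPi m).real (vectorEvent m ε β) := by
      have h := hβ m hm
      rw [gaussianMatrix_omegaEvent hx₀,
        ENNReal.ofReal_le_iff_le_toReal (measure_ne_top _ _)] at h
      rwa [← neg_mul]
    have := hcgProp.mul_log_le_of_vectorEvent hcg hε1.le hr hprob hx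
      ((inv_le_iff_one_le_mul₀ hx0).1 hxβ.le)
    linarith
  refine hle.trans_lt ?_
  have hinv : (2 + 2 * e) / (cg ^ 2 * e) * (ε / log (1 / ε)) =
      (cg ^ 2 * e / (2 + 2 * e) * (log (1 / ε) / ε))⁻¹ := by
    rw [mul_inv, inv_div, inv_div]
  rw [hinv]
  exact inv_strictAnti₀ (by positivity) hXx

theorem betaMax_bounds (n : ℕ) (x₀ : Fin n → ℝ) (hx₀ : ∑ j, x₀ j ^ 2 = 1)
    (cg : ℝ) (hcg : 0 < cg) (hcgProp : cgProperty cg)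
    (εg : ℝ)
    (hεg : εg = sSup {t : ℝ | ∃ x : ℝ, 2 ≤ x ∧ t = (cg ^ 2 * Real.log (2 * x) - 1) / (x - 1)})
    (α : ℝ) (hα0 : 0 < α) (hα1 : α < 1)
    (ε : ℝ) (hε0 : 0 < ε)
    (hε : ε < min ((1 - Real.sqrt α) / 4) (min εg (4 * εg ^ 2))) :
    ((1 - Real.sqrt α) / 32) * (ε / Real.log (1 / ε)) < betaMax n x₀ ε α ∧
      betaMax n x₀ ε α < ((2 + 2 * εg) / (cg ^ 2 * εg)) * (ε / Real.log (1 / ε)) := by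
  obtain ⟨hεα, hε⟩ := lt_min_iff.1 hε
  obtain ⟨hεe, -⟩ := lt_min_iff.1 hε
  refine ⟨lower_bound_lt_betaMax hx₀ hα0 hα1 hε0 hεα,
    betaMax_lt_upper_bound hx₀ hcg hcgProp hεg hα0 hε0 ?_ hεe⟩
  linarith [sqrt_nonneg α]
end

section
/- Let n ∈ ℕ, fix x₀ ∈ ℝ^n with ‖x₀‖ = 1, and let c_g be a positive constant with the order-statistics property below. Then for every 0 < β < 1: (π/6)(1 − β)² · min((3 − 2β)/(4(1 − β)), 1) ≤ θ^max_β ≤ min((π/2)(ln(1/β))², 1), and max(c_g² ln(2/(1 − β)), (π/2)β²) ≤ ω^min_β ≤ 2 ln(e/(1 − β)). -/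
open MeasureTheory ProbabilityTheory Real

/-- The event `Ω_{[θ,∞],β}`: `(1/|T|)‖A_T x₀‖² ≥ θ` for all `T` with `|Tᶜ| ≤ βm`. -/
def omegaLowEvent (m n : ℕ) (x₀ : Fin n → ℝ) (θ β : ℝ) : Set (Fin m → Fin n → ℝ) :=
  {A | ∀ T : Finset (Fin m), (Tᶜ.card : ℝ) ≤ β * m →
    θ ≤ (1 / (T.card : ℝ)) * subNormSq A x₀ T}

/-- The event `Ω_{[0,ω],β}`: `(1/|T|)‖A_T x₀‖² ≤ ω` for all `T` with `|Tᶜ| ≤ βm`. -/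
def omegaHighEvent (m n : ℕ) (x₀ : Fin n → ℝ) (ω β : ℝ) : Set (Fin m → Fin n → ℝ) :=
  {A | ∀ T : Finset (Fin m), (Tᶜ.card : ℝ) ≤ β * m →
    (1 / (T.card : ℝ)) * subNormSq A x₀ T ≤ ω}

/-- `θ^max_β(α)`. -/
noncomputable def thetaMaxAlpha (n : ℕ) (x₀ : Fin n → ℝ) (β α : ℝ) : ℝ :=
  sSup {θ : ℝ | 0 ≤ θ ∧ ∀ m : ℕ, 0 < m →
    ENNReal.ofReal (1 - Real.exp (-α * m)) ≤ gaussianMatrix m n (omegaLowEvent m n x₀ θ β)}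

/-- `ω^min_β(α)`. -/
noncomputable def omegaMinAlpha (n : ℕ) (x₀ : Fin n → ℝ) (β α : ℝ) : ℝ :=
  sInf {ω : ℝ | 0 ≤ ω ∧ ∀ m : ℕ, 0 < m →
    ENNReal.ofReal (1 - Real.exp (-α * m)) ≤ gaussianMatrix m n (omegaHighEvent m n x₀ ω β)}

/-- `θ^max_β := sup_{α>0} θ^max_β(α)`. -/
noncomputable def thetaMax (n : ℕ) (x₀ : Fin n → ℝ) (β : ℝ) : ℝ :=
  sSup {t : ℝ | ∃ α : ℝ, 0 < α ∧ t = thetaMaxAlpha n x₀ β α}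

/-- `ω^min_β := inf_{α>0} ω^min_β(α)`. -/
noncomputable def omegaMin (n : ℕ) (x₀ : Fin n → ℝ) (β : ℝ) : ℝ :=
  sInf {t : ℝ | ∃ α : ℝ, 0 < α ∧ t = omegaMinAlpha n x₀ β α}

/-- A linear combination of i.i.d. standard Gaussians with unit coefficient vector is standard
Gaussian. -/
lemma map_sum_mul_pi_gaussianReal {n : ℕ} (x : Fin n → ℝ) (hx : ∑ j, x j ^ 2 = 1) :
    (Measure.pi fun _ : Fin n => gaussianReal 0 1).map (fun a => ∑ j, a j * x j)
      = gaussianReal 0 1 := by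
  have hmeas : Measurable fun a : Fin n → ℝ => ∑ j, a j * x j := by fun_prop
  have : IsProbabilityMeasure
      ((Measure.pi fun _ : Fin n => gaussianReal 0 1).map fun a => ∑ j, a j * x j) :=
    Measure.isProbabilityMeasure_map hmeas.aemeasurable
  apply Measure.ext_of_charFun
  ext t
  rw [charFun_apply_real, integral_map hmeas.aemeasurable (by fun_prop), charFun_gaussianReal]
  have hprod : ∀ a : Fin n → ℝ,
      Complex.exp (t * ((∑ j, a j * x j : ℝ) : ℂ) * Complex.I)
        = ∏ j, Complex.exp (((t * x j : ℝ) : ℂ) * (a j : ℂ) * Complex.I) := by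
    intro a
    rw [← Complex.exp_sum]
    push_cast
    rw [Finset.mul_sum, Finset.sum_mul]
    congr 1
    exact Finset.sum_congr rfl fun j _ => by ring
  simp_rw [hprod]
  rw [integral_fintype_prod_eq_prod
    (f := fun (j : Fin n) (y : ℝ) => Complex.exp (((t * x j : ℝ) : ℂ) * (y : ℂ) * Complex.I))]
  simp_rw [← charFun_apply_real, charFun_gaussianReal]
  rw [← Complex.exp_sum]
  congr 1
  have hx' : ∑ j, (x j : ℂ) ^ 2 = 1 := by exact_mod_cast hx
  push_cast
  simp only [mul_zero, zero_mul, zero_sub, one_mul]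
  rw [Finset.sum_neg_distrib, ← Finset.sum_div]
  simp_rw [mul_pow]
  rw [← Finset.mul_sum, hx', mul_one]

lemma map_gaussianMatrix {m n : ℕ} (x : Fin n → ℝ) (hx : ∑ j, x j ^ 2 = 1) :
    (gaussianMatrix m n).map (fun A i => ∑ j, A i j * x j) = stdGaussianPi m := by
  have hmeas : Measurable fun a : Fin n → ℝ => ∑ j, a j * x j := by fun_prop
  have hmap := map_sum_mul_pi_gaussianReal x hx
  unfold gaussianMatrix stdGaussianPi
  rw [Measure.pi_map_pi (f := fun (_ : Fin m) (a : Fin n → ℝ) => ∑ j, a j * x j)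
    (hμ := fun _ => by rw [hmap]; infer_instance) (fun _ => hmeas.aemeasurable)]
  simp_rw [hmap]

/-- The vector version of `omegaLowEvent`. -/
def lowSet (m : ℕ) (θ β : ℝ) : Set (Fin m → ℝ) :=
  {y | ∀ T : Finset (Fin m), (Tᶜ.card : ℝ) ≤ β * m →
    θ ≤ (1 / (T.card : ℝ)) * ∑ i ∈ T, y i ^ 2}

/-- The vector version of `omegaHighEvent`. -/
def highSet (m : ℕ) (ω β : ℝ) : Set (Fin m → ℝ) :=
  {y | ∀ T : Finset (Fin m), (Tᶜ.card : ℝ) ≤ β * m →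
    (1 / (T.card : ℝ)) * ∑ i ∈ T, y i ^ 2 ≤ ω}

lemma measurableSet_lowSet (m : ℕ) (θ β : ℝ) : MeasurableSet (lowSet m θ β) := by
  simp only [lowSet, Set.ofPred_forall]
  refine MeasurableSet.iInter fun T => MeasurableSet.iInter fun _ => ?_
  exact measurableSet_le (by fun_prop) (by fun_prop)

lemma measurableSet_highSet (m : ℕ) (ω β : ℝ) : MeasurableSet (highSet m ω β) := by
  simp only [highSet, Set.ofPred_forall]
  refine MeasurableSet.iInter fun T => MeasurableSet.iInter fun _ => ?_
  exact measurableSet_le (by fun_prop) (by fun_prop)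

lemma gaussianMatrix_omegaLowEvent {m n : ℕ} (x : Fin n → ℝ) (hx : ∑ j, x j ^ 2 = 1) (θ β : ℝ) :
    gaussianMatrix m n (omegaLowEvent m n x θ β) = stdGaussianPi m (lowSet m θ β) := by
  rw [← map_gaussianMatrix x hx, Measure.map_apply (by fun_prop) (measurableSet_lowSet m θ β)]
  rfl

lemma gaussianMatrix_omegaHighEvent {m n : ℕ} (x : Fin n → ℝ) (hx : ∑ j, x j ^ 2 = 1) (ω β : ℝ) :
    gaussianMatrix m n (omegaHighEvent m n x ω β) = stdGaussianPi m (highSet m ω β) := by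
  rw [← map_gaussianMatrix x hx, Measure.map_apply (by fun_prop) (measurableSet_highSet m ω β)]
  rfl

lemma stdGaussianPi_real_le_mgf_pow {W : ℝ → ℝ} {t : ℝ} (ht : 0 ≤ t)
    (hint : Integrable (fun y => exp (t * W y)) (gaussianReal 0 1)) (a : ℝ) (m : ℕ) :
    (stdGaussianPi m).real {y | a * m ≤ ∑ i, W (y i)}
      ≤ (exp (-t * a) * mgf W (gaussianReal 0 1) t) ^ m := by
  have hexp : ∀ y : Fin m → ℝ, exp (t * ∑ i, W (y i)) = ∏ i, exp (t * W (y i)) := by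
    intro y
    rw [Finset.mul_sum, Real.exp_sum]
  have hI : Integrable (fun y : Fin m → ℝ => exp (t * ∑ i, W (y i))) (stdGaussianPi m) := by
    simp_rw [hexp]
    exact Integrable.fintype_prod (f := fun (_ : Fin m) (y : ℝ) => exp (t * W y)) fun _ => hint
  have hmgf : mgf (fun y : Fin m → ℝ => ∑ i, W (y i)) (stdGaussianPi m) t
      = mgf W (gaussianReal 0 1) t ^ m := by
    simp only [mgf, hexp]
    unfold stdGaussianPi
    rw [integral_fintype_prod_eq_pow (ι := Fin m) (fun y => exp (t * W y)), Fintype.card_fin]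
  refine (measure_ge_le_exp_mul_mgf (a * m) ht hI).trans_eq ?_
  rw [hmgf, mul_pow, ← Real.exp_nat_mul]
  congr 2
  ring

/-- **Chernoff bound**: the empirical mean of `W` exceeds any level above its expectation with
exponentially small probability, uniformly in the sample size. -/
lemma exists_chernoff {W : ℝ → ℝ}
    (h0 : 0 ∈ interior (integrableExpSet W (gaussianReal 0 1))) {a : ℝ}
    (ha : ∫ y, W y ∂gaussianReal 0 1 < a) :
    ∃ α : ℝ, 0 < α ∧ ∀ m : ℕ,
      (stdGaussianPi m).real {y | a * m ≤ ∑ i, W (y i)} ≤ exp (-α * m) := by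
  set μ := gaussianReal 0 1
  have hd : HasDerivAt (fun t => exp (-t * a) * mgf W μ t) (∫ y, W y ∂μ - a) 0 := by
    have h1 : HasDerivAt (mgf W μ) (∫ y, W y ∂μ) 0 := by
      simpa using hasDerivAt_mgf h0
    have h2 : HasDerivAt (fun t : ℝ => exp (-t * a)) (-a) 0 := by
      have := (((hasDerivAt_id (0 : ℝ)).neg).mul_const a).exp
      simpa using this
    have := h2.mul h1
    simp only [neg_zero, zero_mul, Real.exp_zero, mgf_zero, one_mul] at this
    rwa [show -a * 1 + ∫ y, W y ∂μ = ∫ y, W y ∂μ - a by ring] at this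
  have hlt : ∀ᶠ t in nhdsWithin (0 : ℝ) (Set.Ioi 0), exp (-t * a) * mgf W μ t < 1 := by
    have hs := hd.tendsto_slope
    have hs' := (hs.mono_left (nhdsWithin_mono 0 (s := Set.Ioi 0) fun t ht => ne_of_gt ht)).eventually
      (gt_mem_nhds (sub_neg.2 ha))
    filter_upwards [hs', self_mem_nhdsWithin] with t ht htpos
    rw [slope_def_field] at ht
    have htpos : 0 < t := htpos
    have h1 := mul_neg_of_neg_of_pos ht (show 0 < t - 0 by simpa using htpos)
    rw [div_mul_cancel₀ _ (by simpa using htpos.ne')] at h1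
    simpa using h1
  have hmem : ∀ᶠ t in nhdsWithin (0 : ℝ) (Set.Ioi 0), t ∈ integrableExpSet W μ :=
    nhdsWithin_le_nhds (mem_interior_iff_mem_nhds.1 h0)
  obtain ⟨t, ⟨ht1, ht2⟩, ht0⟩ := ((hlt.and hmem).and self_mem_nhdsWithin).exists
  have ht0 : 0 < t := ht0
  set r := exp (-t * a) * mgf W μ t
  have hr : 0 < r := mul_pos (Real.exp_pos _) (mgf_pos ht2)
  refine ⟨-Real.log r, by have := Real.log_neg hr ht1; linarith, fun m => ?_⟩
  refine (stdGaussianPi_real_le_mgf_pow ht0.le ht2 a m).trans_eq ?_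
  rw [neg_neg, mul_comm (Real.log r), Real.exp_nat_mul, Real.exp_log hr]

lemma zero_mem_interior_integrableExpSet {W : ℝ → ℝ} (hW : Measurable W) {K : ℝ}
    (hK : ∀ y, |W y| ≤ K + y ^ 2) : 0 ∈ interior (integrableExpSet W (gaussianReal 0 1)) := by
  obtain ⟨C, hC, hint⟩ := IsGaussian.exists_integrable_exp_sq (gaussianReal 0 1)
  rw [mem_interior_iff_mem_nhds]
  filter_upwards [Ioo_mem_nhds (neg_lt_zero.2 hC) hC] with t ht
  refine (hint.const_mul (exp (C * K))).mono' (by fun_prop) (ae_of_all _ fun y => ?_)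
  rw [Real.norm_eq_abs, abs_of_pos (Real.exp_pos _), ← Real.exp_add, Real.exp_le_exp,
    Real.norm_eq_abs, sq_abs]
  calc t * W y ≤ |t * W y| := le_abs_self _
    _ = |t| * |W y| := abs_mul _ _
    _ ≤ C * (K + y ^ 2) :=
      mul_le_mul (abs_le.2 ⟨ht.1.le, ht.2.le⟩) (hK y) (abs_nonneg _) hC.le
    _ = C * K + C * y ^ 2 := by ring

lemma integrable_of_abs_le_add_sq {W : ℝ → ℝ} (hW : Measurable W) {K : ℝ}
    (hK : ∀ y, |W y| ≤ K + y ^ 2) : Integrable W (gaussianReal 0 1) := by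
  have h2 : Integrable (fun y : ℝ => y ^ 2) (gaussianReal 0 1) := by
    simpa using (memLp_id_gaussianReal (μ := 0) (v := 1) 2).integrable_sq
  exact ((integrable_const K).add h2).mono' hW.aestronglyMeasurable (ae_of_all _ hK)

lemma integrable_sq_gaussianReal : Integrable (fun y : ℝ => y ^ 2) (gaussianReal 0 1) :=
  integrable_of_abs_le_add_sq (K := 0) (by fun_prop) fun y => by simp

/-- The density of `|Y|` on `(0, ∞)`, where `Y` is standard normal. -/
noncomputable def halfNormalPDF (u : ℝ) : ℝ := √(2 / π) * exp (-u ^ 2 / 2)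

lemma continuous_halfNormalPDF : Continuous halfNormalPDF := by
  unfold halfNormalPDF; fun_prop

lemma halfNormalPDF_nonneg (u : ℝ) : 0 ≤ halfNormalPDF u := by
  unfold halfNormalPDF; positivity

lemma halfNormalPDF_le (u : ℝ) : halfNormalPDF u ≤ √(2 / π) := by
  unfold halfNormalPDF
  refine mul_le_of_le_one_right (by positivity) (Real.exp_le_one_iff.2 ?_)
  nlinarith [sq_nonneg u]

lemma integrable_halfNormalPDF : Integrable halfNormalPDF := by
  unfold halfNormalPDF
  refine Integrable.const_mul ?_ _
  convert integrable_exp_neg_mul_sq (show (0 : ℝ) < 1 / 2 by norm_num) using 3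
  ring

lemma integral_comp_abs_gaussianReal (g : ℝ → ℝ) :
    ∫ y, g |y| ∂gaussianReal 0 1 = ∫ u in Set.Ioi 0, halfNormalPDF u * g u := by
  rw [integral_gaussianReal_eq_integral_smul one_ne_zero]
  have h1 : ∀ y : ℝ, gaussianPDFReal 0 1 y • g |y|
      = (fun u => 2⁻¹ * (halfNormalPDF u * g u)) |y| := by
    intro y
    have h2 : (√(2 * π))⁻¹ = 2⁻¹ * √(2 / π) := by
      rw [inv_mul_eq_div, Real.sqrt_div (by norm_num), Real.sqrt_mul (by norm_num)]
      have : √(2 : ℝ) * √2 = 2 := Real.mul_self_sqrt (by norm_num)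
      have hp : √π ≠ 0 := by positivity
      field_simp
      linarith
    simp only [gaussianPDFReal, NNReal.coe_one, mul_one, h2, halfNormalPDF, smul_eq_mul, sq_abs,
      sub_zero]
    ring
  simp_rw [h1]
  rw [integral_comp_abs (f := fun u => 2⁻¹ * (halfNormalPDF u * g u)), integral_const_mul]
  ring

lemma real_abs_mem_gaussianReal {s : Set ℝ} (hs : MeasurableSet s) :
    (gaussianReal 0 1).real {y | |y| ∈ s} = ∫ u in Set.Ioi 0 ∩ s, halfNormalPDF u := by
  have hs' : MeasurableSet {y : ℝ | |y| ∈ s} := (continuous_abs.measurable) hs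
  rw [← setIntegral_indicator hs, ← integral_indicator_one hs']
  have := integral_comp_abs_gaussianReal (s.indicator 1)
  have h1 : ∀ y : ℝ, ({y : ℝ | |y| ∈ s}.indicator 1 y : ℝ) = s.indicator 1 |y| := fun _ => rfl
  have h2 : ∀ u : ℝ, s.indicator halfNormalPDF u = halfNormalPDF u * s.indicator 1 u := fun u => by
    by_cases hu : u ∈ s <;> simp [hu]
  simp_rw [h1, h2, this]

lemma real_lt_abs_gaussianReal {t : ℝ} (ht : 0 ≤ t) :
    (gaussianReal 0 1).real {y | t < |y|} = ∫ u in Set.Ioi t, halfNormalPDF u := by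
  have := real_abs_mem_gaussianReal (measurableSet_Ioi (a := t))
  rwa [Set.inter_eq_right.2 (Set.Ioi_subset_Ioi ht)] at this

lemma real_abs_le_gaussianReal (t : ℝ) :
    (gaussianReal 0 1).real {y | |y| ≤ t} = ∫ u in Set.Ioc 0 t, halfNormalPDF u := by
  exact real_abs_mem_gaussianReal (measurableSet_Iic (a := t))

lemma real_lt_abs_add_real_abs_le (t : ℝ) :
    (gaussianReal 0 1).real {y | t < |y|} + (gaussianReal 0 1).real {y | |y| ≤ t} = 1 := by
  have hs : MeasurableSet {y : ℝ | |y| ≤ t} :=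
    measurableSet_le continuous_abs.measurable measurable_const
  have := probReal_add_probReal_compl (μ := gaussianReal 0 1) hs
  rw [add_comm]
  convert this using 3
  ext y
  simp

lemma real_abs_le_gaussianReal_le {t : ℝ} (ht : 0 ≤ t) :
    (gaussianReal 0 1).real {y | |y| ≤ t} ≤ √(2 / π) * t := by
  rw [real_abs_le_gaussianReal]
  refine (setIntegral_mono integrable_halfNormalPDF.integrableOn (by simp)
    halfNormalPDF_le).trans_eq ?_
  simp [ht, mul_comm]

lemma real_lt_abs_gaussianReal_le_exp_sq {t : ℝ} (ht : 0 ≤ t) :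
    (gaussianReal 0 1).real {y | t < |y|} ≤ exp (-t ^ 2 / 2) := by
  have h0 : ∫ u in Set.Ioi 0, halfNormalPDF u = 1 := by
    have := integral_comp_abs_gaussianReal 1
    simpa using this.symm
  rw [real_lt_abs_gaussianReal ht]
  have hshift : ∫ u in Set.Ioi t, halfNormalPDF u = ∫ u in Set.Ioi 0, halfNormalPDF (u + t) := by
    simpa using
      ((measurePreserving_add_right volume t).setIntegral_preimage_emb
        (measurableEmbedding_addRight t) halfNormalPDF (Set.Ioi t)).symm
  rw [hshift]
  calc ∫ u in Set.Ioi 0, halfNormalPDF (u + t)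
      ≤ ∫ u in Set.Ioi 0, exp (-t ^ 2 / 2) * halfNormalPDF u := by
        refine setIntegral_mono_on (integrable_halfNormalPDF.comp_add_right t).integrableOn
          (integrable_halfNormalPDF.const_mul _).integrableOn measurableSet_Ioi fun u hu => ?_
        have hu : 0 < u := hu
        unfold halfNormalPDF
        rw [mul_left_comm, ← Real.exp_add]
        gcongr
        nlinarith [mul_nonneg hu.le ht]
    _ = exp (-t ^ 2 / 2) := by rw [integral_const_mul, h0, mul_one]

lemma real_lt_abs_gaussianReal_le_exp {t : ℝ} (ht : 0 ≤ t) :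
    (gaussianReal 0 1).real {y | t < |y|} ≤ exp (-√(2 / π) * t) := by
  set κ := √(2 / π) with hκ
  have hκ0 : 0 < κ := by positivity
  rcases le_total t (2 * κ) with h | h
  · have h1 : 1 - exp (-κ * t) ≤ (gaussianReal 0 1).real {y | |y| ≤ t} := by
      have h2 : ∫ u in (0 : ℝ)..t, κ * exp (-κ * u) = 1 - exp (-κ * t) := by
        rw [intervalIntegral.integral_eq_sub_of_hasDerivAt (f := fun u => -exp (-κ * u))]
        · simp; ring
        · intro u _
          have := (((hasDerivAt_id u).const_mul (-κ)).exp).neg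
          rwa [mul_one, mul_comm, neg_mul_eq_neg_mul, neg_neg] at this
        · exact Continuous.intervalIntegrable (by fun_prop) _ _
      rw [real_abs_le_gaussianReal, ← intervalIntegral.integral_of_le ht, ← h2]
      refine intervalIntegral.integral_mono_on ht (Continuous.intervalIntegrable (by fun_prop) _ _)
        (continuous_halfNormalPDF.intervalIntegrable _ _) fun u hu => ?_
      unfold halfNormalPDF
      rw [← hκ]
      gcongr
      nlinarith [hu.1, hu.2]
    linarith [real_lt_abs_add_real_abs_le t]
  · have h2 : ∫ u in Set.Ioi t, κ * exp (-κ * u) = exp (-κ * t) := by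
      rw [integral_const_mul, integral_exp_mul_Ioi (by linarith)]
      field_simp
    rw [real_lt_abs_gaussianReal ht, ← h2]
    refine setIntegral_mono_on integrable_halfNormalPDF.integrableOn
      ((integrableOn_exp_mul_Ioi (by linarith) _).const_mul _) measurableSet_Ioi fun u hu => ?_
    have hu : t < u := hu
    unfold halfNormalPDF
    rw [← hκ]
    gcongr
    nlinarith

lemma integral_max_sq_sub_sq_le {q : ℝ} (hq : 0 ≤ q) :
    ∫ y, max (q ^ 2 - y ^ 2) 0 ∂gaussianReal 0 1 ≤ √(2 / π) * (2 / 3 * q ^ 3) := by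
  have h1 := integral_comp_abs_gaussianReal fun u => max (q ^ 2 - u ^ 2) 0
  simp only [sq_abs] at h1
  have h2 : ∫ u in (0 : ℝ)..q, √(2 / π) * (q ^ 2 - u ^ 2) = √(2 / π) * (2 / 3 * q ^ 3) := by
    rw [intervalIntegral.integral_const_mul, intervalIntegral.integral_sub (by simp) (by simp),
      integral_pow, intervalIntegral.integral_const]
    simp
    ring_nf
    tauto
  rw [h1, ← h2, intervalIntegral.integral_of_le hq,
    ← Set.Ioi_inter_Iic, ← setIntegral_indicator measurableSet_Iic]
  refine integral_mono_of_nonneg (ae_of_all _ fun u => mul_nonneg (halfNormalPDF_nonneg u)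
    (le_max_right _ _)) ?_ ?_
  · refine (IntegrableOn.integrable_indicator ?_ measurableSet_Iic)
    rw [IntegrableOn, Measure.restrict_restrict measurableSet_Iic, Set.inter_comm,
      Set.Ioi_inter_Iic]
    exact (Continuous.integrableOn_Icc (by fun_prop)).mono_set Set.Ioc_subset_Icc_self
  · filter_upwards [ae_restrict_mem measurableSet_Ioi] with u hu
    have hu : 0 < u := hu
    by_cases huq : u ≤ q
    · have : 0 ≤ q ^ 2 - u ^ 2 := by nlinarith
      rw [Set.indicator_of_mem (by exact huq), max_eq_left this]
      exact mul_le_mul_of_nonneg_right (halfNormalPDF_le u) this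
    · have : q ^ 2 - u ^ 2 ≤ 0 := by nlinarith
      rw [Set.indicator_of_notMem (by exact huq), max_eq_right this, mul_zero]

lemma integral_max_sq_sub_le {s : ℝ} (hs : 0 ≤ s) :
    ∫ y, max (y ^ 2 - s) 0 ∂gaussianReal 0 1 ≤ 2 * exp (-s / 2) := by
  have hI : Integrable (fun y : ℝ => max (y ^ 2 - s) 0) (gaussianReal 0 1) :=
    integrable_of_abs_le_add_sq (K := 0) (by fun_prop) fun y => by
      rw [abs_of_nonneg (le_max_right _ _)]
      exact max_le (by linarith) (by positivity)
  rw [hI.integral_eq_integral_meas_lt (ae_of_all _ fun y => le_max_right _ _)]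
  have h2 : ∫ t in Set.Ioi (0 : ℝ), exp (-s / 2) * exp (-(1 / 2) * t) = 2 * exp (-s / 2) := by
    rw [integral_const_mul, integral_exp_mul_Ioi (by norm_num)]
    norm_num
    ring
  rw [← h2]
  refine integral_mono_of_nonneg (ae_of_all _ fun t => measureReal_nonneg)
    ((integrableOn_exp_mul_Ioi (by norm_num) _).const_mul _) ?_
  filter_upwards [ae_restrict_mem measurableSet_Ioi] with t ht
  have ht : 0 < t := ht
  have hset : {y : ℝ | t < max (y ^ 2 - s) 0} = {y | √(s + t) < |y|} := by
    ext y
    simp only [Set.mem_ofPred_eq, lt_max_iff, ht.not_gt, or_false]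
    rw [← Real.sqrt_sq_eq_abs, Real.sqrt_lt_sqrt_iff (by linarith)]
    constructor <;> intro h <;> linarith
  rw [hset, ← Real.exp_add]
  refine (real_lt_abs_gaussianReal_le_exp_sq (Real.sqrt_nonneg _)).trans_eq ?_
  rw [Real.sq_sqrt (by linarith)]
  congr 1
  ring

lemma ofReal_le_of_compl_subset {m : ℕ} {S B : Set (Fin m → ℝ)} (hS : MeasurableSet S)
    (hSB : Sᶜ ⊆ B) {p : ℝ} (hB : (stdGaussianPi m).real B ≤ p) :
    ENNReal.ofReal (1 - p) ≤ stdGaussianPi m S := by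
  rw [← ofReal_measureReal]
  refine ENNReal.ofReal_le_ofReal ?_
  have h1 := probReal_add_probReal_compl (μ := stdGaussianPi m) hS
  have h2 : (stdGaussianPi m).real Sᶜ ≤ (stdGaussianPi m).real B := measureReal_mono hSB
  linarith

lemma real_compl_le_of_ofReal_le {m : ℕ} {S : Set (Fin m → ℝ)} (hS : MeasurableSet S) {p : ℝ}
    (h : ENNReal.ofReal (1 - p) ≤ stdGaussianPi m S) : (stdGaussianPi m).real Sᶜ ≤ p := by
  have h1 := probReal_add_probReal_compl (μ := stdGaussianPi m) hS
  have h2 : 1 - p ≤ (stdGaussianPi m).real S :=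
    (ENNReal.ofReal_le_iff_le_toReal (measure_ne_top _ _)).1 h
  linarith

/-- Events of overwhelming probability cannot be contained in Chernoff tail events. -/
lemma not_forall_subset_tail {W : ℝ → ℝ} (hW : Measurable W) {K : ℝ}
    (hK : ∀ y, |W y| ≤ K + y ^ 2) {a : ℝ} (ha : ∫ y, W y ∂gaussianReal 0 1 < a)
    {S : ∀ m : ℕ, Set (Fin m → ℝ)} {α : ℝ} (hα : 0 < α)
    (hS : ∀ m : ℕ, 0 < m → ENNReal.ofReal (1 - exp (-α * m)) ≤ stdGaussianPi m (S m))
    (hsub : ∀ m : ℕ, 0 < m → S m ⊆ {y | a * m ≤ ∑ i, W (y i)}) : False := by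
  obtain ⟨α', hα', h⟩ := exists_chernoff (zero_mem_interior_integrableExpSet hW hK) ha
  have hlim : ∀ b : ℝ, 0 < b →
      Filter.Tendsto (fun m : ℕ => exp (-b * m)) Filter.atTop (nhds 0) := fun b hb => by
    refine Real.tendsto_exp_atBot.comp ?_
    exact tendsto_natCast_atTop_atTop.const_mul_atTop_of_neg (neg_lt_zero.2 hb)
  have hev := ((hlim α hα).add (hlim α' hα')).eventually (gt_mem_nhds (show (0 : ℝ) + 0 < 1 by simp))
  obtain ⟨m, hm, hm0⟩ := (hev.and (Filter.eventually_gt_atTop 0)).exists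
  have h2 : 1 - exp (-α * m) ≤ (stdGaussianPi m).real (S m) :=
    (ENNReal.ofReal_le_iff_le_toReal (measure_ne_top _ _)).1 (hS m hm0)
  have h3 : (stdGaussianPi m).real (S m) ≤ _ := measureReal_mono (hsub m hm0)
  linarith [h m]

lemma mul_le_card_of_card_compl_le {m : ℕ} {β : ℝ} {T : Finset (Fin m)}
    (hT : (Tᶜ.card : ℝ) ≤ β * m) : (1 - β) * m ≤ T.card := by
  have h : (T.card : ℝ) + Tᶜ.card = m := by
    exact_mod_cast (by simp)
  linarith

lemma card_pos_of_card_compl_le {m : ℕ} {β : ℝ} (hβ : β < 1) (hm : 0 < m) {T : Finset (Fin m)}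
    (hT : (Tᶜ.card : ℝ) ≤ β * m) : (0 : ℝ) < T.card :=
  (mul_pos (sub_pos.2 hβ) (Nat.cast_pos.2 hm)).trans_le (mul_le_card_of_card_compl_le hT)

/-- For `θ` below `π (1 - β)² / 6` the lower event has overwhelming probability. -/
lemma exists_rate_lowSet {β θ : ℝ} (hβ : β < 1) (hθ0 : 0 ≤ θ)
    (hθ : θ < π / 6 * (1 - β) ^ 2) : ∃ α : ℝ, 0 < α ∧ ∀ m : ℕ, 0 < m →
      ENNReal.ofReal (1 - exp (-α * m)) ≤ stdGaussianPi m (lowSet m θ β) := by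
  set γ := 1 - β with hγ
  have hγ0 : 0 < γ := sub_pos.2 hβ
  set q := γ * √(π / 2) with hq
  have hq0 : 0 < q := by positivity
  have hq2 : q ^ 2 = γ ^ 2 * (π / 2) := by rw [hq, mul_pow, Real.sq_sqrt (by positivity)]
  have hqκ : √(2 / π) * q = γ := by
    rw [hq, mul_left_comm, ← Real.sqrt_mul (by positivity)]
    rw [show 2 / π * (π / 2) = 1 by field_simp, Real.sqrt_one, mul_one]
  have hW : Measurable fun y : ℝ => max (q ^ 2 - y ^ 2) 0 := by fun_prop
  have hEW : ∫ y, max (q ^ 2 - y ^ 2) 0 ∂gaussianReal 0 1 < γ * (q ^ 2 - θ) := by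
    refine (integral_max_sq_sub_sq_le hq0.le).trans_lt ?_
    have : √(2 / π) * (2 / 3 * q ^ 3) = γ * (2 / 3 * q ^ 2) := by rw [← hqκ]; ring
    rw [this]
    gcongr
    nlinarith
  obtain ⟨α, hα, h⟩ := exists_chernoff (zero_mem_interior_integrableExpSet hW (K := q ^ 2)
    fun y => by
      rw [abs_of_nonneg (le_max_right _ _)]
      exact max_le (by nlinarith [sq_nonneg y]) (by positivity)) hEW
  refine ⟨α, hα, fun m hm => ofReal_le_of_compl_subset (measurableSet_lowSet m θ β) ?_ (h m)⟩
  intro y hy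
  by_contra hlt
  refine hy fun T hT => ?_
  have hT0 := card_pos_of_card_compl_le hβ hm hT
  have hTγ := mul_le_card_of_card_compl_le hT
  simp only [Set.mem_ofPred_eq, not_le] at hlt
  rw [one_div_mul_eq_div, le_div_iff₀ hT0]
  have h1 : ∑ i ∈ T, max (q ^ 2 - y i ^ 2) 0 ≤ ∑ i, max (q ^ 2 - y i ^ 2) 0 :=
    Finset.sum_le_sum_of_subset_of_nonneg (Finset.subset_univ T) fun _ _ _ => le_max_right _ _
  have h2 : ∑ i ∈ T, (q ^ 2 - y i ^ 2) ≤ ∑ i ∈ T, max (q ^ 2 - y i ^ 2) 0 :=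
    Finset.sum_le_sum fun _ _ => le_max_left _ _
  rw [Finset.sum_sub_distrib, Finset.sum_const, nsmul_eq_mul] at h2
  have h3 : (q ^ 2 - θ) * (γ * m) ≤ (q ^ 2 - θ) * T.card := by
    refine mul_le_mul_of_nonneg_left hTγ ?_
    nlinarith [Real.pi_pos, sq_nonneg γ]
  nlinarith

/-- For `ω` above `2 ln (e / (1 - β))` the upper event has overwhelming probability. -/
lemma exists_rate_highSet {β ω : ℝ} (hβ0 : 0 < β) (hβ : β < 1)
    (hω : 2 * Real.log (exp 1 / (1 - β)) < ω) : ∃ α : ℝ, 0 < α ∧ ∀ m : ℕ, 0 < m →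
      ENNReal.ofReal (1 - exp (-α * m)) ≤ stdGaussianPi m (highSet m ω β) := by
  set γ := 1 - β with hγ
  have hγ0 : 0 < γ := sub_pos.2 hβ
  set s := -(2 * Real.log γ) with hs
  have hs0 : 0 ≤ s := by
    have := Real.log_nonpos hγ0.le (by linarith)
    linarith
  rw [Real.log_div (Real.exp_pos 1).ne' hγ0.ne', Real.log_exp] at hω
  have hW : Measurable fun y : ℝ => max (y ^ 2 - s) 0 := by fun_prop
  have hEW : ∫ y, max (y ^ 2 - s) 0 ∂gaussianReal 0 1 < γ * (ω - s) := by
    refine (integral_max_sq_sub_le hs0).trans_lt ?_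
    rw [show -s / 2 = Real.log γ by rw [hs]; ring, Real.exp_log hγ0, mul_comm]
    gcongr
    linarith
  obtain ⟨α, hα, h⟩ := exists_chernoff (zero_mem_interior_integrableExpSet hW (K := 0)
    fun y => by
      rw [abs_of_nonneg (le_max_right _ _)]
      exact max_le (by linarith) (by positivity)) hEW
  refine ⟨α, hα, fun m hm => ofReal_le_of_compl_subset (measurableSet_highSet m ω β) ?_ (h m)⟩
  intro y hy
  by_contra hlt
  refine hy fun T hT => ?_
  have hT0 := card_pos_of_card_compl_le hβ hm hT
  have hTγ := mul_le_card_of_card_compl_le hT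
  simp only [Set.mem_ofPred_eq, not_le] at hlt
  rw [one_div_mul_eq_div, div_le_iff₀ hT0]
  have h1 : ∑ i ∈ T, max (y i ^ 2 - s) 0 ≤ ∑ i, max (y i ^ 2 - s) 0 :=
    Finset.sum_le_sum_of_subset_of_nonneg (Finset.subset_univ T) fun _ _ _ => le_max_right _ _
  have h2 : ∑ i ∈ T, (y i ^ 2 - s) ≤ ∑ i ∈ T, max (y i ^ 2 - s) 0 :=
    Finset.sum_le_sum fun _ _ => le_max_left _ _
  rw [Finset.sum_sub_distrib, Finset.sum_const, nsmul_eq_mul] at h2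
  have h3 : (ω - s) * (γ * m) ≤ (ω - s) * T.card :=
    mul_le_mul_of_nonneg_left hTγ (by linarith)
  nlinarith

/-- Every exponential rate is attained by the upper event for some level. -/
lemma exists_level_highSet {β : ℝ} (hβ : β < 1) (α : ℝ) :
    ∃ ω : ℝ, 0 ≤ ω ∧ ∀ m : ℕ, 0 < m →
      ENNReal.ofReal (1 - exp (-α * m)) ≤ stdGaussianPi m (highSet m ω β) := by
  obtain ⟨C, hC, hint⟩ := IsGaussian.exists_integrable_exp_sq (gaussianReal 0 1)
  simp only [Real.norm_eq_abs, sq_abs] at hint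
  set M := mgf (fun y : ℝ => y ^ 2) (gaussianReal 0 1) C
  have hM : 0 < M := mgf_pos hint
  have hγ0 : 0 < 1 - β := sub_pos.2 hβ
  set a := max 0 ((α + Real.log M) / C) with ha
  have hMa : exp (-C * a) * M ≤ exp (-α) := by
    rw [← Real.exp_log hM, ← Real.exp_add, Real.exp_le_exp]
    have := (div_le_iff₀' hC).1 (le_max_right 0 ((α + Real.log M) / C))
    linarith
  have ha0 : 0 ≤ a := le_max_left _ _
  refine ⟨a / (1 - β), by positivity, fun m hm => ?_⟩
  have h := stdGaussianPi_real_le_mgf_pow hC.le hint a m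
  refine ofReal_le_of_compl_subset (measurableSet_highSet m _ β) (B := {y | a * m ≤ ∑ i, y i ^ 2})
    ?_ (h.trans ?_)
  · intro y hy
    by_contra hlt
    refine hy fun T hT => ?_
    have hT0 := card_pos_of_card_compl_le hβ hm hT
    have hTγ := mul_le_card_of_card_compl_le hT
    simp only [Set.mem_ofPred_eq, not_le] at hlt
    rw [one_div_mul_eq_div, div_le_iff₀ hT0]
    have h1 : ∑ i ∈ T, y i ^ 2 ≤ ∑ i, y i ^ 2 :=
      Finset.sum_le_sum_of_subset_of_nonneg (Finset.subset_univ T) fun _ _ _ => sq_nonneg _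
    have h2 : a / (1 - β) * ((1 - β) * m) ≤ a / (1 - β) * T.card :=
      mul_le_mul_of_nonneg_left hTγ (by positivity)
    have h3 : a / (1 - β) * ((1 - β) * m) = a * m := by field_simp
    linarith
  · calc (exp (-C * a) * M) ^ m ≤ exp (-α) ^ m := by gcongr
      _ = exp (-α * m) := by rw [← Real.exp_nat_mul, mul_comm]

/-- The indicator of `s`, summed over a sample, counts the sample points in `s`. -/
lemma sum_indicator_one_eq_card {m : ℕ} (s : Set ℝ) [DecidablePred (· ∈ s)] (y : Fin m → ℝ) :
    ∑ i, s.indicator (1 : ℝ → ℝ) (y i) = ((Finset.univ.filter fun i => y i ∈ s).card : ℝ) := by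
  rw [Finset.card_filter]
  push_cast
  exact Finset.sum_congr rfl fun i _ => by by_cases h : y i ∈ s <;> simp [h]

lemma abs_indicator_one_le (s : Set ℝ) (y : ℝ) : |s.indicator (1 : ℝ → ℝ) y| ≤ 1 + y ^ 2 := by
  by_cases h : y ∈ s <;> simp [h] <;> positivity

lemma measurableSet_lt_abs (t : ℝ) : MeasurableSet {y : ℝ | t < |y|} :=
  measurableSet_lt measurable_const continuous_abs.measurable

lemma measurableSet_abs_le (t : ℝ) : MeasurableSet {y : ℝ | |y| ≤ t} :=
  measurableSet_le continuous_abs.measurable measurable_const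

lemma le_log_sq_of_lowSet {β θ α : ℝ} (hβ0 : 0 < β) (hβ : β < 1) (hα : 0 < α)
    (h : ∀ m : ℕ, 0 < m → ENNReal.ofReal (1 - exp (-α * m)) ≤ stdGaussianPi m (lowSet m θ β)) :
    θ ≤ π / 2 * Real.log (1 / β) ^ 2 := by
  by_contra! hθ
  set L := Real.log (1 / β) with hL
  have hL0 : 0 ≤ L := Real.log_nonneg (by rw [le_div_iff₀ hβ0]; linarith)
  have hlt : √(π / 2) * L < √θ := by
    refine Real.lt_sqrt_of_sq_lt ?_
    rwa [mul_pow, Real.sq_sqrt (by positivity)]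
  obtain ⟨t, ht1, ht2⟩ := exists_between hlt
  have ht0 : 0 ≤ t := le_trans (by positivity) ht1.le
  have htθ : t ^ 2 < θ := (Real.lt_sqrt ht0).1 ht2
  have hP : (gaussianReal 0 1).real {y | t < |y|} < β := by
    refine (real_lt_abs_gaussianReal_le_exp ht0).trans_lt ?_
    have h1 : exp (-L) = β := by
      rw [hL, one_div, Real.log_inv, neg_neg, Real.exp_log hβ0]
    rw [← h1, Real.exp_lt_exp]
    have h2 : √(2 / π) * (√(π / 2) * L) < √(2 / π) * t := by gcongr
    rw [← mul_assoc, ← Real.sqrt_mul (by positivity), show 2 / π * (π / 2) = 1 by field_simp,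
      Real.sqrt_one, one_mul] at h2
    linarith
  have hs := measurableSet_lt_abs t
  refine not_forall_subset_tail (measurable_one.indicator hs) (abs_indicator_one_le _)
    (a := β) (by rwa [integral_indicator_one hs]) hα h fun m hm y hy => ?_
  classical
  by_contra hc
  rw [Set.mem_ofPred_eq, sum_indicator_one_eq_card, not_le] at hc
  set T : Finset (Fin m) := (Finset.univ.filter fun i => y i ∈ {y : ℝ | t < |y|})ᶜ
  have hT : (Tᶜ.card : ℝ) ≤ β * m := by rw [compl_compl]; exact hc.le
  have hT0 := card_pos_of_card_compl_le hβ hm hT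
  have h1 := hy T hT
  rw [one_div_mul_eq_div, le_div_iff₀ hT0] at h1
  have h2 : ∑ i ∈ T, y i ^ 2 ≤ ∑ i ∈ T, t ^ 2 := by
    refine Finset.sum_le_sum fun i hi => ?_
    have : |y i| ≤ t := by simpa [T] using hi
    exact sq_le_sq.2 (this.trans (le_abs_self t))
  rw [Finset.sum_const, nsmul_eq_mul] at h2
  nlinarith

lemma le_one_of_lowSet {β θ α : ℝ} (hβ0 : 0 < β) (hα : 0 < α)
    (h : ∀ m : ℕ, 0 < m → ENNReal.ofReal (1 - exp (-α * m)) ≤ stdGaussianPi m (lowSet m θ β)) :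
    θ ≤ 1 := by
  by_contra! hθ
  refine not_forall_subset_tail (W := fun y => y ^ 2) (by fun_prop) (K := 0) (fun y => by simp)
    (a := θ) (by rwa [integral_sq_gaussianReal]) hα h fun m hm y hy => ?_
  have h1 := hy Finset.univ (by simp; positivity)
  rw [one_div_mul_eq_div, le_div_iff₀ (by simpa using hm)] at h1
  simpa using h1

lemma mul_sq_le_of_highSet {β ω α : ℝ} (hβ0 : 0 < β) (hβ : β < 1) (hα : 0 < α)
    (h : ∀ m : ℕ, 0 < m → ENNReal.ofReal (1 - exp (-α * m)) ≤ stdGaussianPi m (highSet m ω β)) :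
    π / 2 * β ^ 2 ≤ ω := by
  by_contra! hω
  have hlt : √ω < √(π / 2) * β := by
    rw [Real.sqrt_lt' (by positivity), mul_pow, Real.sq_sqrt (by positivity)]
    exact hω
  obtain ⟨t, ht1, ht2⟩ := exists_between hlt
  have ht0 : 0 < t := (Real.sqrt_nonneg ω).trans_lt ht1
  have htω : ω < t ^ 2 := (Real.sqrt_lt' ht0).1 ht1
  have hP : (gaussianReal 0 1).real {y | |y| ≤ t} < β := by
    refine (real_abs_le_gaussianReal_le ht0.le).trans_lt ?_
    have h2 : √(2 / π) * t < √(2 / π) * (√(π / 2) * β) := by gcongr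
    rwa [← mul_assoc, ← Real.sqrt_mul (by positivity), show 2 / π * (π / 2) = 1 by field_simp,
      Real.sqrt_one, one_mul] at h2
  have hs := measurableSet_abs_le t
  refine not_forall_subset_tail (measurable_one.indicator hs) (abs_indicator_one_le _)
    (a := β) (by rwa [integral_indicator_one hs]) hα h fun m hm y hy => ?_
  classical
  by_contra hc
  rw [Set.mem_ofPred_eq, sum_indicator_one_eq_card, not_le] at hc
  set T : Finset (Fin m) := (Finset.univ.filter fun i => y i ∈ {y : ℝ | |y| ≤ t})ᶜ
  have hT : (Tᶜ.card : ℝ) ≤ β * m := by rw [compl_compl]; exact hc.le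
  have hT0 := card_pos_of_card_compl_le hβ hm hT
  have h1 := hy T hT
  rw [one_div_mul_eq_div, div_le_iff₀ hT0] at h1
  have h2 : ∑ i ∈ T, t ^ 2 ≤ ∑ i ∈ T, y i ^ 2 := by
    refine Finset.sum_le_sum fun i hi => ?_
    have : t < |y i| := by simpa [T] using hi
    exact sq_le_sq.2 ((abs_of_pos ht0).trans_le this.le)
  rw [Finset.sum_const, nsmul_eq_mul] at h2
  nlinarith

lemma one_le_of_highSet {β ω α : ℝ} (hβ0 : 0 < β) (hα : 0 < α)
    (h : ∀ m : ℕ, 0 < m → ENNReal.ofReal (1 - exp (-α * m)) ≤ stdGaussianPi m (highSet m ω β)) :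
    1 ≤ ω := by
  by_contra! hω
  refine not_forall_subset_tail (W := fun y => -y ^ 2) (by fun_prop) (K := 0) (fun y => by simp)
    (a := -ω) (by rw [integral_neg, integral_sq_gaussianReal]; linarith) hα h fun m hm y hy => ?_
  have h1 := hy Finset.univ (by simp; positivity)
  rw [one_div_mul_eq_div, div_le_iff₀ (by simpa using hm)] at h1
  simpa using h1

lemma absOrd_nonneg {m : ℕ} (y : Fin m → ℝ) (j : Fin m) : 0 ≤ absOrd y j := abs_nonneg _

/-- The `j + 1` largest entries dominate the order statistic `absOrd y j`. -/
lemma exists_finset_absOrd_le {m : ℕ} (y : Fin m → ℝ) (j : Fin m) :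
    ∃ T : Finset (Fin m), T.card = j + 1 ∧ ∀ i ∈ T, absOrd y j ≤ |y i| := by
  refine ⟨(Finset.Iic j).map (Tuple.sort fun i => -|y i|).toEmbedding, by simp, fun i hi => ?_⟩
  obtain ⟨k, hk, rfl⟩ := Finset.mem_map.1 hi
  have := Tuple.monotone_sort (fun i => -|y i|) (Finset.mem_Iic.1 hk)
  exact neg_le_neg_iff.1 this

/-- If the order statistic is at most `s` outside an event of probability at most `p`, its
expectation is at most `s` up to a second moment correction. -/
lemma integral_absOrd_le {m : ℕ} (j : Fin m) {s δ p : ℝ} (hs : 0 ≤ s) (hδ : 0 < δ)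
    {B : Set (Fin m → ℝ)} (hB : MeasurableSet B) (hp : (stdGaussianPi m).real B ≤ p)
    (h : ∀ y ∉ B, absOrd y j ≤ s) :
    ∫ y, absOrd y j ∂stdGaussianPi m ≤ s + (δ * m + δ⁻¹ * p) / 2 := by
  have hmp : ∀ i, MeasurePreserving (fun y : Fin m → ℝ => y i) (stdGaussianPi m)
      (gaussianReal 0 1) := fun i => measurePreserving_eval _ i
  have hsq : ∀ i, Integrable (fun y : Fin m → ℝ => y i ^ 2) (stdGaussianPi m) := fun i =>
    (hmp i).integrable_comp_of_integrable integrable_sq_gaussianReal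
  have hint : ∀ i, ∫ y, y i ^ 2 ∂stdGaussianPi m = 1 := fun i => by
    rw [← integral_sq_gaussianReal, ← (hmp i).map_eq,
      integral_map (hmp i).aemeasurable (by fun_prop)]
  have hIB : Integrable (fun y => B.indicator (1 : (Fin m → ℝ) → ℝ) y) (stdGaussianPi m) :=
    (integrable_const 1).indicator hB
  have hIsum : Integrable (fun y : Fin m → ℝ => ∑ i, y i ^ 2) (stdGaussianPi m) :=
    integrable_finsetSum _ fun i _ => hsq i
  calc ∫ y, absOrd y j ∂stdGaussianPi m
      ≤ ∫ y, s + (δ * ∑ i, y i ^ 2 + δ⁻¹ * B.indicator (1 : (Fin m → ℝ) → ℝ) y) / 2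
          ∂stdGaussianPi m := by
        refine integral_mono_of_nonneg (ae_of_all _ fun y => absOrd_nonneg y j)
          ((integrable_const s).add (((hIsum.const_mul δ).add (hIB.const_mul δ⁻¹)).div_const 2))
          (ae_of_all _ fun y => ?_)
        have hnn : 0 ≤ δ * ∑ i, y i ^ 2 := by positivity
        by_cases hy : y ∈ B
        · set k := Tuple.sort (fun i => -|y i|) j
          have h1 : y k ^ 2 ≤ ∑ i, y i ^ 2 :=
            Finset.single_le_sum (fun i _ => sq_nonneg (y i)) (Finset.mem_univ k)
          have h2 : 2 * |y k| ≤ δ * y k ^ 2 + δ⁻¹ := by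
            have h3 : 0 ≤ δ⁻¹ * (δ * |y k| - 1) ^ 2 := by positivity
            have h4 : δ⁻¹ * (δ * |y k| - 1) ^ 2 = δ * y k ^ 2 + δ⁻¹ - 2 * |y k| := by
              rw [← sq_abs (y k)]
              field_simp
              ring
            linarith
          have h5 : δ * y k ^ 2 ≤ δ * ∑ i, y i ^ 2 := by gcongr
          simp only [hy, Set.indicator_of_mem, Pi.one_apply, absOrd]
          linarith
        · simp only [hy, not_false_eq_true, Set.indicator_of_notMem]
          linarith [h y hy]
    _ = s + (δ * m + δ⁻¹ * (stdGaussianPi m).real B) / 2 := by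
        have hI : Integrable (fun y : Fin m → ℝ =>
            δ * ∑ i, y i ^ 2 + δ⁻¹ * B.indicator (1 : (Fin m → ℝ) → ℝ) y) (stdGaussianPi m) :=
          (hIsum.const_mul δ).add (hIB.const_mul δ⁻¹)
        rw [integral_add (integrable_const _) (hI.div_const 2), integral_div,
          integral_add (hIsum.const_mul δ) (hIB.const_mul δ⁻¹), integral_const_mul,
          integral_const_mul, integral_finsetSum _ fun i _ => hsq i,
          integral_indicator_one hB]
        simp [hint]
    _ ≤ s + (δ * m + δ⁻¹ * p) / 2 := by gcongr

/-- The order-statistics property transfers a bound for `absOrd`, valid outside events of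
exponentially small probability, to the limit of the logarithmic factors. -/
lemma cgProperty.mul_sqrt_log_le {c : ℝ} (hc : cgProperty c) {s α ℓ : ℝ}
    (hs : 0 ≤ s) (hα : 0 < α)
    (j : ∀ k : ℕ, 0 < k → Fin (2 * k)) (hj : ∀ k (hk : 0 < k), (j k hk : ℕ) + 1 ≤ k)
    {L : ℕ → ℝ} (hL : Filter.Tendsto L Filter.atTop (nhds ℓ))
    (hjL : ∀ k (hk : 0 < k), c * √(L k) ≤
      c * √(Real.log (2 * (2 * k : ℕ) / ((j k hk : ℕ) + 1))))
    (B : ∀ m : ℕ, Set (Fin m → ℝ)) (hBm : ∀ m, MeasurableSet (B m))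
    (hB : ∀ m, 0 < m → (stdGaussianPi m).real (B m) ≤ exp (-α * m))
    (h : ∀ k (hk : 0 < k), ∀ y ∉ B (2 * k), absOrd y (j k hk) ≤ s) :
    c * √ℓ ≤ s := by
  have hlim : Filter.Tendsto (fun k : ℕ => s + (2 * (k * exp (-α * k)) + exp (-α * k)) / 2)
      Filter.atTop (nhds (s + (2 * 0 + 0) / 2)) := by
    have h1 := (tendsto_rpow_mul_exp_neg_mul_atTop_nhds_zero 1 α hα).comp
      tendsto_natCast_atTop_atTop
    have h0 := (tendsto_rpow_mul_exp_neg_mul_atTop_nhds_zero 0 α hα).comp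
      tendsto_natCast_atTop_atTop
    simp only [Function.comp_def, Real.rpow_one, Real.rpow_zero, one_mul] at h0 h1
    exact (((h1.const_mul 2).add h0).div_const 2).const_add s
  simp only [mul_zero, add_zero, zero_div] at hlim
  refine le_of_tendsto_of_tendsto ((hL.sqrt).const_mul c) hlim ?_
  filter_upwards [Filter.eventually_gt_atTop 0] with k hk
  refine (hjL k hk).trans ((hc (2 * k) (j k hk) (by have := hj k hk; omega)).trans ?_)
  refine (integral_absOrd_le (j k hk) hs (Real.exp_pos (-α * k)) (hBm _)
    (hB (2 * k) (by omega)) (h k hk)).trans_eq ?_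
  rw [← Real.exp_neg, ← Real.exp_add]
  push_cast
  ring_nf

lemma cgProperty.mul_sqrt_log_four_le_one {c : ℝ} (hc : cgProperty c) :
    c * √(Real.log 4) ≤ 1 := by
  have hs := measurableSet_lt_abs 1
  have hW : Measurable ({y : ℝ | 1 < |y|}.indicator (1 : ℝ → ℝ)) := measurable_one.indicator hs
  have hP : ∫ y, {y : ℝ | 1 < |y|}.indicator (1 : ℝ → ℝ) y ∂gaussianReal 0 1 < 1 / 2 := by
    rw [integral_indicator_one hs]
    refine (real_lt_abs_gaussianReal_le_exp zero_le_one).trans_lt ?_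
    rw [mul_one, ← Real.lt_log_iff_exp_lt (by norm_num), one_div, Real.log_inv, neg_lt_neg_iff]
    refine Real.lt_sqrt_of_sq_lt ?_
    rw [lt_div_iff₀ Real.pi_pos]
    have h1 := Real.log_two_lt_d9
    have h2 := Real.log_pos (one_lt_two : (1 : ℝ) < 2)
    have h3 : Real.log 2 ^ 2 ≤ 0.5 := by nlinarith
    nlinarith [Real.pi_lt_d2, Real.pi_pos]
  obtain ⟨α, hα, h⟩ := exists_chernoff
    (zero_mem_interior_integrableExpSet hW (abs_indicator_one_le _)) hP
  refine hc.mul_sqrt_log_le zero_le_one hα (fun k hk => ⟨k - 1, by omega⟩)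
    (fun k hk => by simp; omega) (L := fun _ => Real.log 4) tendsto_const_nhds
    (fun k hk => ?_) (fun m => {y | (1 / 2 : ℝ) * m ≤ ∑ i, {y : ℝ | 1 < |y|}.indicator 1 (y i)})
    (fun m => measurableSet_le measurable_const
      (Finset.measurable_fun_sum Finset.univ fun i _ =>
        show Measurable fun y : Fin m → ℝ => {y : ℝ | 1 < |y|}.indicator (1 : ℝ → ℝ) (y i) from
          hW.comp (measurable_pi_apply i)))
    (fun m _ => h m) fun k hk y hy => ?_
  · have hk' : (0 : ℝ) < k := Nat.cast_pos.2 hk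
    have : ((k - 1 : ℕ) : ℝ) + 1 = k := by
      rw [Nat.cast_sub (by omega)]
      simp
    rw [this]
    refine le_of_eq ?_
    congr 3
    push_cast
    field_simp
    norm_num
  · classical
    by_contra! hlt
    refine hy ?_
    rw [Set.mem_ofPred_eq, sum_indicator_one_eq_card]
    obtain ⟨T, hT, hTy⟩ := exists_finset_absOrd_le y ⟨k - 1, by omega⟩
    have hsub : T ⊆ Finset.univ.filter fun i => y i ∈ {y : ℝ | 1 < |y|} := fun i hi => by
      simpa using hlt.trans_le (hTy i hi)
    have hcard := Finset.card_le_card hsub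
    have hTk : T.card = k := by simp at hT; omega
    rw [hTk] at hcard
    have : (k : ℝ) ≤ _ := Nat.cast_le.2 hcard
    push_cast
    linarith

lemma mul_log_le_of_highSet {c : ℝ} (hc : cgProperty c) (hc0 : 0 < c) {β ω α : ℝ} (hβ0 : 0 < β)
    (hβ : β < 1) (hα : 0 < α)
    (h : ∀ m : ℕ, 0 < m → ENNReal.ofReal (1 - exp (-α * m)) ≤ stdGaussianPi m (highSet m ω β)) :
    c ^ 2 * Real.log (2 / (1 - β)) ≤ ω := by
  have hω1 := one_le_of_highSet hβ0 hα h
  set γ := 1 - β with hγ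
  have hγ0 : 0 < γ := sub_pos.2 hβ
  have hlog0 : 0 ≤ Real.log (2 / γ) := Real.log_nonneg (by rw [le_div_iff₀ hγ0]; linarith)
  suffices hmain : c * √(Real.log (2 / γ)) ≤ √ω by
    have := pow_le_pow_left₀ (by positivity) hmain 2
    rwa [mul_pow, Real.sq_sqrt hlog0, Real.sq_sqrt (by linarith)] at this
  rcases le_total (1 / 2) γ with hγ2 | hγ2
  · calc c * √(Real.log (2 / γ)) ≤ c * √(Real.log 4) := by
          gcongr
          rw [div_le_iff₀ hγ0]
          linarith
      _ ≤ 1 := hc.mul_sqrt_log_four_le_one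
      _ ≤ √ω := Real.one_le_sqrt.2 hω1
  have hceil : ∀ k : ℕ, 0 < k → 0 < ⌈2 * γ * k⌉₊ ∧ ⌈2 * γ * k⌉₊ ≤ k := fun k hk => by
    have hk' : (0 : ℝ) < k := Nat.cast_pos.2 hk
    refine ⟨Nat.ceil_pos.2 (by positivity), Nat.ceil_le.2 ?_⟩
    nlinarith
  have hcast : ∀ k : ℕ, 0 < k → ((⌈2 * γ * k⌉₊ - 1 : ℕ) : ℝ) + 1 = ⌈2 * γ * k⌉₊ := fun k hk => by
    rw [Nat.cast_sub (hceil k hk).1]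
    simp
  refine hc.mul_sqrt_log_le (Real.sqrt_nonneg ω) hα
    (fun k hk => ⟨⌈2 * γ * k⌉₊ - 1, by have := hceil k hk; omega⟩)
    (fun k hk => by have := hceil k hk; simp only; omega)
    (L := fun k : ℕ => Real.log (2 / (γ + 1 / 2 * (1 / (k : ℝ))))) ?_ (fun k hk => ?_)
    (fun m => (highSet m ω β)ᶜ) (fun m => (measurableSet_highSet m ω β).compl)
    (fun m hm => real_compl_le_of_ofReal_le (measurableSet_highSet m ω β) (h m hm))
    fun k hk y hy => ?_
  · have h1 : Filter.Tendsto (fun k : ℕ => γ + 1 / 2 * (1 / (k : ℝ))) Filter.atTop (nhds γ) := by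
      simpa using ((tendsto_one_div_atTop_nhds_zero_nat (𝕜 := ℝ)).const_mul (1 / 2 : ℝ)).const_add γ
    exact (tendsto_const_nhds.div h1 hγ0.ne').log (by positivity)
  · have hk' : (0 : ℝ) < k := Nat.cast_pos.2 hk
    have hc1 : (0 : ℝ) < ⌈2 * γ * k⌉₊ := Nat.cast_pos.2 (hceil k hk).1
    rw [hcast k hk]
    gcongr c * √(Real.log ?_)
    rw [div_le_div_iff₀ (by positivity) hc1]
    have := (Nat.ceil_lt_add_one (show 0 ≤ 2 * γ * k by positivity)).le
    have h3 : (γ + 1 / 2 * (1 / (k : ℝ))) * k = γ * k + 1 / 2 := by field_simp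
    push_cast
    nlinarith
  · rw [Set.mem_compl_iff, not_not] at hy
    obtain ⟨T, hT, hTy⟩ := exists_finset_absOrd_le y
      ⟨⌈2 * γ * k⌉₊ - 1, by have := hceil k hk; omega⟩
    have hTc : (T.card : ℝ) = ⌈2 * γ * k⌉₊ := by
      rw [hT]
      push_cast
      exact hcast k hk
    have hTge : 2 * γ * k ≤ T.card := hTc ▸ Nat.le_ceil _
    have hcard : (Tᶜ.card : ℝ) ≤ β * (2 * k : ℕ) := by
      have h1 : (T.card : ℝ) + Tᶜ.card = (2 * k : ℕ) := by exact_mod_cast (by simp)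
      push_cast at h1 ⊢
      nlinarith
    have hT0 : (0 : ℝ) < T.card := card_pos_of_card_compl_le hβ (by omega) hcard
    have h1 := hy T hcard
    rw [one_div_mul_eq_div, div_le_iff₀ hT0] at h1
    refine Real.le_sqrt_of_sq_le (le_of_mul_le_mul_right (h1.trans' ?_) hT0)
    rw [mul_comm, ← nsmul_eq_mul, ← Finset.sum_const]
    refine Finset.sum_le_sum fun i hi => ?_
    rw [← sq_abs (y i)]
    exact pow_le_pow_left₀ (absOrd_nonneg _ _) (hTy i hi) 2

lemma lowSet_zero (m : ℕ) (β : ℝ) : lowSet m 0 β = Set.univ :=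
  Set.eq_univ_of_forall fun y T _ => by positivity

theorem thetaMax_omegaMin_bounds (n : ℕ) (x₀ : Fin n → ℝ) (hx₀ : ∑ j, x₀ j ^ 2 = 1)
    (cg : ℝ) (hcg : 0 < cg) (hcgProp : cgProperty cg)
    (β : ℝ) (hβ0 : 0 < β) (hβ1 : β < 1) :
    ((π / 6) * (1 - β) ^ 2 * min ((3 - 2 * β) / (4 * (1 - β))) 1 ≤ thetaMax n x₀ β ∧
      thetaMax n x₀ β ≤ min ((π / 2) * (Real.log (1 / β)) ^ 2) 1) ∧
    (max (cg ^ 2 * Real.log (2 / (1 - β))) ((π / 2) * β ^ 2) ≤ omegaMin n x₀ β ∧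
      omegaMin n x₀ β ≤ 2 * Real.log (Real.exp 1 / (1 - β))) := by
  have hγ0 : 0 < 1 - β := sub_pos.2 hβ1
  set U := min ((π / 2) * (Real.log (1 / β)) ^ 2) 1 with hU
  set V := max (cg ^ 2 * Real.log (2 / (1 - β))) ((π / 2) * β ^ 2) with hV
  have hθbdd : ∀ α : ℝ, 0 < α → U ∈ upperBounds {θ : ℝ | 0 ≤ θ ∧ ∀ m : ℕ, 0 < m →
      ENNReal.ofReal (1 - Real.exp (-α * m))
        ≤ gaussianMatrix m n (omegaLowEvent m n x₀ θ β)} := by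
    rintro α hα θ ⟨-, h⟩
    simp only [gaussianMatrix_omegaLowEvent x₀ hx₀] at h
    exact le_min (le_log_sq_of_lowSet hβ0 hβ1 hα h) (le_one_of_lowSet hβ0 hα h)
  have hωbdd : ∀ α : ℝ, 0 < α → V ∈ lowerBounds {ω : ℝ | 0 ≤ ω ∧ ∀ m : ℕ, 0 < m →
      ENNReal.ofReal (1 - Real.exp (-α * m))
        ≤ gaussianMatrix m n (omegaHighEvent m n x₀ ω β)} := by
    rintro α hα ω ⟨-, h⟩
    simp only [gaussianMatrix_omegaHighEvent x₀ hx₀] at h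
    exact max_le (mul_log_le_of_highSet hcgProp hcg hβ0 hβ1 hα h)
      (mul_sq_le_of_highSet hβ0 hβ1 hα h)
  have hθα : ∀ α : ℝ, 0 < α → thetaMaxAlpha n x₀ β α ≤ U := fun α hα => by
    refine csSup_le ⟨0, le_rfl, fun m _ => ?_⟩ (hθbdd α hα)
    rw [gaussianMatrix_omegaLowEvent x₀ hx₀, lowSet_zero, measure_univ, ENNReal.ofReal_le_one]
    linarith [Real.exp_pos (-α * m)]
  have hωα : ∀ α : ℝ, 0 < α → V ≤ omegaMinAlpha n x₀ β α := fun α hα => by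
    obtain ⟨ω, hω, h⟩ := exists_level_highSet hβ1 α
    simp only [← gaussianMatrix_omegaHighEvent x₀ hx₀] at h
    exact le_csInf ⟨ω, hω, h⟩ (hωbdd α hα)
  refine ⟨⟨?_, ?_⟩, ?_, ?_⟩
  · refine (mul_le_of_le_one_right (by positivity) (min_le_right _ _)).trans ?_
    refine le_of_forall_lt_imp_le_of_dense fun θ hθ => ?_
    obtain ⟨α, hα, h⟩ := exists_rate_lowSet hβ1 (le_max_right θ 0)
      (max_lt hθ (by positivity : 0 < π / 6 * (1 - β) ^ 2))
    simp only [← gaussianMatrix_omegaLowEvent x₀ hx₀] at h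
    have h1 : max θ 0 ≤ thetaMaxAlpha n x₀ β α :=
      le_csSup ⟨U, hθbdd α hα⟩ ⟨le_max_right θ 0, h⟩
    have h2 : thetaMaxAlpha n x₀ β α ≤ thetaMax n x₀ β :=
      le_csSup ⟨U, by rintro _ ⟨α', hα', rfl⟩; exact hθα α' hα'⟩ ⟨α, hα, rfl⟩
    exact (le_max_left θ 0).trans (h1.trans h2)
  · exact csSup_le ⟨_, 1, one_pos, rfl⟩ (by rintro _ ⟨α', hα', rfl⟩; exact hθα α' hα')
  · exact le_csInf ⟨_, 1, one_pos, rfl⟩ (by rintro _ ⟨α', hα', rfl⟩; exact hωα α' hα')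
  · refine le_of_forall_gt_imp_ge_of_dense fun ω hω => ?_
    obtain ⟨α, hα, h⟩ := exists_rate_highSet hβ0 hβ1 hω
    simp only [← gaussianMatrix_omegaHighEvent x₀ hx₀] at h
    have hω0 : 0 ≤ ω := by
      refine le_trans ?_ hω.le
      have : 0 ≤ Real.log (Real.exp 1 / (1 - β)) := Real.log_nonneg (by
        rw [le_div_iff₀ hγ0]
        linarith [Real.add_one_le_exp 1])
      positivity
    have h1 : omegaMinAlpha n x₀ β α ≤ ω := csInf_le ⟨V, hωbdd α hα⟩ ⟨hω0, h⟩
    have h2 : omegaMin n x₀ β ≤ omegaMinAlpha n x₀ β α :=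
      csInf_le ⟨V, by rintro _ ⟨α', hα', rfl⟩; exact hωα α' hα'⟩ ⟨α, hα, rfl⟩
    exact h2.trans h1
end
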